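/- arXiv:2506.20072 — 4 statements merged into one kernel-verified Lean document; each statement's English description precedes it below -/
import Mathlib

section
/- Let G be a d-regular finite simple graph and let H be a δ-regular graph on the same vertex set as G with δ ≥ 1 and with h edges, and set Δ = d − δ. Assume G contains at least one spanning subgraph isomorphic to H. Then the expected value, over a uniformly random permutation ω of the edges of G, of the fraction of spanning subgraphs of G isomorphic to H that are contained in G_ω, equals 2/binom(h+Δ, h) − 1/binom(h+2Δ, h). -/
open Finset

/-- The degree of a vertex `v` in the graph whose edge set is the finite set `s`
of edges (elements of `Sym2 V`). -/
def degIn {V : Type*} [DecidableEq V] (s : Finset (Sym2 V)) (v : V) : ℕ :=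
  (s.filter (fun e => v ∈ e)).card

/-- Given an ordering `ω` of a finite set `s` of edges, the set consisting of the
first `i` edges `e_{ω(1)}, …, e_{ω(i)}`. -/
def prefixEdges {V : Type*} [DecidableEq V] {s : Finset (Sym2 V)}
    (ω : Fin s.card ≃ {e : Sym2 V // e ∈ s}) (i : ℕ) : Finset (Sym2 V) :=
  (Finset.univ.filter (fun j : Fin s.card => (j : ℕ) < i)).image (fun j => (ω j : Sym2 V))

/-- `k(ω)`: the least `i` such that every vertex has degree at least `δ` in the graph
formed by the first `i` edges of the ordering `ω`. -/
noncomputable def stopIndex {V : Type*} [Fintype V] [DecidableEq V] (δ : ℕ)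
    {s : Finset (Sym2 V)} (ω : Fin s.card ≃ {e : Sym2 V // e ∈ s}) : ℕ :=
  sInf {i | ∀ v : V, δ ≤ degIn (prefixEdges ω i) v}

/-- The edge set of `G_ω`, i.e. the first `k(ω)` edges of the ordering `ω`. -/
noncomputable def finalEdges {V : Type*} [Fintype V] [DecidableEq V] (δ : ℕ)
    {s : Finset (Sym2 V)} (ω : Fin s.card ≃ {e : Sym2 V // e ∈ s}) : Finset (Sym2 V) :=
  prefixEdges ω (stopIndex δ ω)


def ev {α : Type*} {m : ℕ} (A : Finset α) (e : α) (B : Finset α) (ω : Fin m ≃ α) : Prop :=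
  (∀ x ∈ A, ω.symm x < ω.symm e) ∧ (∀ y ∈ B, ω.symm e < ω.symm y)

open Classical in
theorem ev_symm {α : Type*} [Fintype α] [DecidableEq α] {m : ℕ} (A B A' B' : Finset α) (e e' : α)
    (hAB : Disjoint A B) (heA : e ∉ A) (heB : e ∉ B)
    (hAB' : Disjoint A' B') (heA' : e' ∉ A') (heB' : e' ∉ B')
    (hA : #A = #A') (hB : #B = #B') :
    #{ω : Fin m ≃ α | ev A e B ω} = #{ω : Fin m ≃ α | ev A' e' B' ω} := by
  let f : Finset α → Finset α → α → α → Fin 4 := fun A B e x =>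
    if x = e then 0 else if x ∈ A then 1 else if x ∈ B then 2 else 3
  have f0 : ∀ (A B : Finset α) (e : α), e ∉ A → e ∉ B → Disjoint A B →
      Fintype.card {x // f A B e x = 0} = 1 ∧
      Fintype.card {x // f A B e x = 1} = #A ∧
      Fintype.card {x // f A B e x = 2} = #B ∧
      Fintype.card {x // f A B e x = 3} = Fintype.card α - (#A + #B + 1) := by
    intro A B e h1 h2 h3
    have h3' := Finset.disjoint_left.1 h3
    simp only [Fintype.card_subtype]
    refine ⟨?_, ?_, ?_, ?_⟩
    · rw [Finset.card_eq_one]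
      refine ⟨e, ?_⟩
      ext x; simp only [f, mem_filter, mem_univ, true_and, mem_singleton]
      split_ifs <;> simp_all
    · congr 1
      ext x; simp only [f, mem_filter, mem_univ, true_and]
      split_ifs <;> simp_all
    · congr 1
      ext x; simp only [f, mem_filter, mem_univ, true_and]
      split_ifs with a1 a2 a3 <;> simp_all
    · have : (univ.filter (fun x => f A B e x = 3)) = (insert e (A ∪ B))ᶜ := by
        ext x; simp only [f, mem_filter, mem_univ, true_and, mem_compl, mem_insert, mem_union]
        split_ifs <;> simp_all
      rw [this, card_compl, card_insert_of_notMem (by simp [h1, h2]), card_union_of_disjoint h3]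
  have hc : ∀ c, Fintype.card {x // f A B e x = c} = Fintype.card {x // f A' B' e' x = c} := by
    obtain ⟨a0, a1, a2, a3⟩ := f0 A B e heA heB hAB
    obtain ⟨b0, b1, b2, b3⟩ := f0 A' B' e' heA' heB' hAB'
    intro c
    fin_cases c
    · exact a0.trans b0.symm
    · exact a1.trans (hA.trans b1.symm)
    · exact a2.trans (hB.trans b2.symm)
    · rw [hA, hB] at a3
      exact a3.trans b3.symm
  let σ : α ≃ α := (Equiv.sigmaFiberEquiv (f A B e)).symm.trans
    ((Equiv.sigmaCongrRight (fun c => Fintype.equivOfCardEq (hc c))).trans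
      (Equiv.sigmaFiberEquiv (f A' B' e')))
  have hσ : ∀ x, f A' B' e' (σ x) = f A B e x := by
    intro x
    exact (Fintype.equivOfCardEq (hc (f A B e x)) ⟨x, rfl⟩).2
  have mm : ∀ (A B : Finset α) (e x : α), e ∉ A → e ∉ B → Disjoint A B →
      ((x = e ↔ f A B e x = 0) ∧ (x ∈ A ↔ f A B e x = 1) ∧ (x ∈ B ↔ f A B e x = 2)) := by
    intro A B e x h1 h2 h3
    have h3' := Finset.disjoint_left.1 h3
    simp only [f]
    split_ifs with a1 a2 a3 <;> simp_all
  have m1 := fun x => mm A B e x heA heB hAB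
  have m2 := fun x => mm A' B' e' x heA' heB' hAB'
  have se : σ e = e' := by
    rw [(m2 _).1, hσ, ← (m1 _).1]
  have sA : ∀ x, σ x ∈ A' ↔ x ∈ A := by
    intro x; rw [(m2 _).2.1, hσ, ← (m1 _).2.1]
  have sB : ∀ x, σ x ∈ B' ↔ x ∈ B := by
    intro x; rw [(m2 _).2.2, hσ, ← (m1 _).2.2]
  refine Finset.card_equiv (Equiv.equivCongr (Equiv.refl _) σ) ?_
  intro ω
  rw [mem_filter, mem_filter]
  simp only [mem_univ, true_and, ev]
  rw [← se]
  have hw : ∀ x, (Equiv.equivCongr (Equiv.refl (Fin m)) σ ω).symm (σ x) = ω.symm x := by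
    intro x; simp [Equiv.equivCongr]
  constructor
  · rintro ⟨h1, h2⟩
    refine ⟨fun x hx => ?_, fun x hx => ?_⟩
    · obtain ⟨y, rfl⟩ := σ.surjective x
      rw [hw, hw]; exact h1 y ((sA y).1 hx)
    · obtain ⟨y, rfl⟩ := σ.surjective x
      rw [hw, hw]; exact h2 y ((sB y).1 hx)
  · rintro ⟨h1, h2⟩
    refine ⟨fun x hx => ?_, fun x hx => ?_⟩
    · have := h1 _ ((sA x).2 hx)
      rwa [hw, hw] at this
    · have := h2 _ ((sB x).2 hx)
      rwa [hw, hw] at this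

open Classical in
theorem ev_count {α : Type*} [Fintype α] [DecidableEq α] {m : ℕ} (A B : Finset α) (e : α)
    (hAB : Disjoint A B) (heA : e ∉ A) (heB : e ∉ B) :
    (#A + #B + 1) * (#A + #B).choose #A * #{ω : Fin m ≃ α | ev A e B ω} =
      Fintype.card (Fin m ≃ α) := by
  set S := insert e (A ∪ B) with hS
  have cS : #S = #A + #B + 1 := by
    rw [hS, card_insert_of_notMem (by simp [heA, heB]), card_union_of_disjoint hAB]
  have key : ∀ ω : Fin m ≃ α,
      ∑ e' ∈ S, ∑ A' ∈ powersetCard #A (S.erase e'),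
        (if ev A' e' ((S.erase e') \ A') ω then 1 else 0) = 1 := by
    intro ω
    let r : α → ℕ := fun x => #{y ∈ S | ω.symm y < ω.symm x}
    have rlt : ∀ x ∈ S, ∀ z, ω.symm x < ω.symm z → r x < r z := by
      intro x hx z hxz
      apply Finset.card_lt_card
      rw [Finset.ssubset_iff_of_subset]
      · exact ⟨x, by simp [hx, hxz], by simp⟩
      · intro y; simp only [mem_filter]; rintro ⟨h1, h2⟩; exact ⟨h1, h2.trans hxz⟩
    have rinj : Set.InjOn r S := by
      intro x hx z hz hxz
      rcases lt_trichotomy (ω.symm x) (ω.symm z) with h | h | h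
      · have := rlt x hx z h; omega
      · exact ω.symm.injective h
      · have := rlt z hz x h; omega
    have rim : S.image r = range #S := by
      apply Finset.eq_of_subset_of_card_le
      · intro n hn
        obtain ⟨x, hx, rfl⟩ := mem_image.1 hn
        rw [mem_range]
        apply Finset.card_lt_card
        rw [Finset.ssubset_iff_of_subset (filter_subset _ _)]
        exact ⟨x, hx, by simp⟩
      · rw [card_image_of_injOn rinj, card_range]
    have ha : #A ∈ S.image r := by rw [rim, cS, mem_range]; omega
    obtain ⟨x, hx, hxa⟩ := mem_image.1 ha
    have inner : ∀ e' ∈ S, ∀ A' ∈ powersetCard #A (S.erase e'),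
        (ev A' e' ((S.erase e') \ A') ω ↔ e' = x ∧ A' = {y ∈ S | ω.symm y < ω.symm x}) := by
      intro e' he' A' hA'
      rw [mem_powersetCard] at hA'
      constructor
      · rintro ⟨h1, h2⟩
        have hAA : A' = {y ∈ S | ω.symm y < ω.symm e'} := by
          ext y
          simp only [mem_filter]
          constructor
          · intro hy; exact ⟨(mem_erase.1 (hA'.1 hy)).2, h1 y hy⟩
          · rintro ⟨hy, hlt⟩
            by_contra hn
            have := h2 y (by
              simp only [mem_sdiff, mem_erase]
              exact ⟨⟨by rintro rfl; simp at hlt, hy⟩, hn⟩)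
            exact absurd hlt (not_lt.2 this.le)
        have : e' = x := by
          apply rinj he' hx
          rw [hxa, ← hA'.2]
          conv_rhs => rw [hAA]
        subst this
        exact ⟨rfl, hAA⟩
      · rintro ⟨rfl, rfl⟩
        refine ⟨by simp, ?_⟩
        intro y hy
        simp only [mem_sdiff, mem_erase, mem_filter, not_and, not_lt] at hy
        exact lt_of_le_of_ne (hy.2 hy.1.2) (fun hh => hy.1.1 (ω.symm.injective hh).symm)
    rw [Finset.sum_eq_single_of_mem x hx]
    · rw [Finset.sum_eq_single_of_mem {y ∈ S | ω.symm y < ω.symm x}]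
      · rw [if_pos]
        rw [inner x hx]
        · simp
        · rw [mem_powersetCard]
          exact ⟨fun y hy => by
            simp only [mem_filter] at hy
            exact mem_erase.2 ⟨by rintro rfl; simp at hy, hy.1⟩, hxa⟩
      · rw [mem_powersetCard]
        exact ⟨fun y hy => by
            simp only [mem_filter] at hy
            exact mem_erase.2 ⟨by rintro rfl; simp at hy, hy.1⟩, hxa⟩
      · intro A' hA' hne
        rw [if_neg]
        rw [inner x hx A' hA']
        exact fun h => hne h.2
    · intro e' he' hne
      apply Finset.sum_eq_zero
      intro A' hA'
      rw [if_neg]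
      rw [inner e' he' A' hA']
      exact fun h => hne h.1
  have key2 : ∑ ω : Fin m ≃ α, ∑ e' ∈ S, ∑ A' ∈ powersetCard #A (S.erase e'),
        (if ev A' e' ((S.erase e') \ A') ω then 1 else 0) = Fintype.card (Fin m ≃ α) := by
    rw [Finset.sum_congr rfl (fun ω _ => key ω)]
    simp
  rw [← key2, Finset.sum_comm]
  have : ∀ e' ∈ S, (∑ ω : Fin m ≃ α, ∑ A' ∈ powersetCard #A (S.erase e'),
        (if ev A' e' ((S.erase e') \ A') ω then 1 else 0)) =
        (#A + #B).choose #A * #{ω : Fin m ≃ α | ev A e B ω} := by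
    intro e' he'
    have cE : #(S.erase e') = #A + #B := by rw [card_erase_of_mem he', cS]; rfl
    rw [Finset.sum_comm, Finset.sum_const_nat (m := #{ω : Fin m ≃ α | ev A e B ω})]
    · rw [card_powersetCard, cE]
    · intro A' hA'
      rw [mem_powersetCard] at hA'
      rw [← Finset.card_filter]
      apply ev_symm
      · exact disjoint_sdiff
      · intro h; exact absurd (hA'.1 h) (by simp)
      · simp
      · exact hAB
      · exact heA
      · exact heB
      · exact hA'.2
      · rw [card_sdiff_of_subset hA'.1, cE, hA'.2]; omega
  rw [Finset.sum_const_nat this, cS, mul_assoc]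

theorem mem_prefixEdges {V : Type*} [DecidableEq V] {s : Finset (Sym2 V)}
    (ω : Fin s.card ≃ {e : Sym2 V // e ∈ s}) (i : ℕ) (x : {e : Sym2 V // e ∈ s}) :
    x.1 ∈ prefixEdges ω i ↔ (ω.symm x : ℕ) < i := by
  simp only [prefixEdges, mem_image, mem_filter, mem_univ, true_and]
  constructor
  · rintro ⟨j, hj, hx⟩
    have : ω j = x := Subtype.ext hx
    rw [← this]; simpa using hj
  · intro hx
    exact ⟨ω.symm x, hx, by simp⟩

theorem prefixEdges_subset {V : Type*} [DecidableEq V] {s : Finset (Sym2 V)}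
    (ω : Fin s.card ≃ {e : Sym2 V // e ∈ s}) (i : ℕ) : prefixEdges ω i ⊆ s := by
  intro x hx
  simp only [prefixEdges, mem_image] at hx
  obtain ⟨j, _, rfl⟩ := hx
  exact (ω j).2

/-- edges of `F` other than `e` -/
def evA {V : Type*} [DecidableEq V] (s F : Finset (Sym2 V)) (e : {e : Sym2 V // e ∈ s}) :
    Finset {e : Sym2 V // e ∈ s} := {x | x.1 ∈ F ∧ x ≠ e}

/-- edges outside `F` at `v` -/
def evB {V : Type*} [DecidableEq V] (s F : Finset (Sym2 V)) (v : V) :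
    Finset {e : Sym2 V // e ∈ s} := {x | v ∈ x.1 ∧ x.1 ∉ F}

theorem subset_final_iff {V : Type*} [Fintype V] [DecidableEq V] [Nonempty V]
    (s F : Finset (Sym2 V)) (hF : F ⊆ s) (δ : ℕ) (hδ : 1 ≤ δ)
    (hFd : ∀ v, degIn F v = δ) (ω : Fin s.card ≃ {e : Sym2 V // e ∈ s}) :
    F ⊆ finalEdges δ ω ↔ ∃ e : {e : Sym2 V // e ∈ s}, e.1 ∈ F ∧ ∃ v ∈ e.1,
      ev (evA s F e) e (evB s F v) ω := by
  have hne : {i | ∀ v : V, δ ≤ degIn (prefixEdges ω i) v}.Nonempty := by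
    refine ⟨s.card, fun v => ?_⟩
    rw [← hFd v]
    apply card_le_card
    apply filter_subset_filter
    intro x hx
    exact (mem_prefixEdges ω _ ⟨x, hF hx⟩).2 (Fin.isLt _)
  constructor
  · intro hsub
    have hFne : ({x | x.1 ∈ F} : Finset {e : Sym2 V // e ∈ s}).Nonempty := by
      obtain ⟨v⟩ := ‹Nonempty V›
      have h1 : 0 < degIn F v := by rw [hFd]; omega
      obtain ⟨x, hx⟩ := card_pos.1 h1
      rw [mem_filter] at hx
      exact ⟨⟨x, hF hx.1⟩, by simp [hx.1]⟩
    obtain ⟨e, he, hmax⟩ := Finset.exists_max_image _ (fun x => ω.symm x) hFne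
    have heF : e.1 ∈ F := by simpa using he
    have hlt : ∀ x : {e : Sym2 V // e ∈ s}, x.1 ∈ F → x ≠ e → ω.symm x < ω.symm e := by
      intro x hx hxe
      exact lt_of_le_of_ne (hmax x (by simpa using hx)) (fun h => hxe (ω.symm.injective h))
    refine ⟨e, heF, ?_⟩
    by_contra hcon
    push Not at hcon
    have hk : stopIndex δ ω ≤ ω.symm e := by
      apply Nat.sInf_le
      intro v
      by_cases hv : v ∈ e.1
      · have h1 := hcon v hv
        have : ∃ y ∈ evB s F v, ω.symm y ≤ ω.symm e := by
          by_contra hh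
          push Not at hh
          refine h1 ⟨fun x hx => ?_, hh⟩
          simp only [evA, mem_filter, mem_univ, true_and] at hx
          exact hlt x hx.1 hx.2
        obtain ⟨y, hy, hye⟩ := this
        simp only [evB, mem_filter, mem_univ, true_and] at hy
        have hye' : ω.symm y < ω.symm e := by
          refine lt_of_le_of_ne hye (fun h => ?_)
          rw [ω.symm.injective h] at hy
          exact hy.2 heF
        have hc : #(insert y.1 ((F.filter (fun e => v ∈ e)).erase e.1)) = δ := by
          have h2 := hFd v
          rw [degIn] at h2
          rw [card_insert_of_notMem (by simp [hy.2]), card_erase_of_mem (by simp [heF, hv]), h2]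
          omega
        rw [← hc]
        apply card_le_card
        intro x hx
        rw [mem_insert, mem_erase, mem_filter] at hx
        rw [mem_filter]
        rcases hx with rfl | ⟨h3, h4, h5⟩
        · exact ⟨(mem_prefixEdges ω _ y).2 hye', hy.1⟩
        · exact ⟨(mem_prefixEdges ω _ ⟨x, hF h4⟩).2
            (hlt _ h4 (fun h => h3 (congrArg Subtype.val h))), h5⟩
      · rw [← hFd v]
        apply card_le_card
        intro x hx
        rw [mem_filter] at hx ⊢
        refine ⟨(mem_prefixEdges ω _ ⟨x, hF hx.1⟩).2 (hlt _ hx.1 ?_), hx.2⟩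
        rintro rfl
        exact hv hx.2
    have := (mem_prefixEdges ω _ e).1 (hsub heF)
    omega
  · rintro ⟨e, heF, v, hv, hA, hB⟩
    have hk : (ω.symm e : ℕ) < stopIndex δ ω := by
      by_contra hcon
      push Not at hcon
      have h1 : δ ≤ degIn (prefixEdges ω (stopIndex δ ω)) v := (Nat.sInf_mem hne) v
      have h2 : degIn (prefixEdges ω (stopIndex δ ω)) v ≤
          #((F.filter (fun e => v ∈ e)).erase e.1) := by
        apply card_le_card
        intro x hx
        rw [mem_filter] at hx
        have hxs := prefixEdges_subset ω _ hx.1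
        have hp := (mem_prefixEdges ω _ ⟨x, hxs⟩).1 hx.1
        rw [mem_erase, mem_filter]
        refine ⟨?_, ?_, hx.2⟩
        · rintro rfl
          exact absurd hp (by simpa using hcon)
        · by_contra hxF
          have := hB ⟨x, hxs⟩ (by simp [evB, hx.2, hxF])
          rw [Fin.lt_def] at this
          omega
      have h3 := hFd v
      rw [degIn] at h3
      rw [card_erase_of_mem (by simp [heF, hv]), h3] at h2
      omega
    intro x hx
    refine (mem_prefixEdges ω _ ⟨x, hF hx⟩).2 ?_
    by_cases hxe : (⟨x, hF hx⟩ : {e : Sym2 V // e ∈ s}) = e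
    · rw [hxe]; exact hk
    · have := hA ⟨x, hF hx⟩ (by simp only [evA, mem_filter, mem_univ, true_and]; exact ⟨hx, hxe⟩)
      rw [Fin.lt_def] at this
      exact this.trans hk

theorem card_subtype_filter {β : Type*} [DecidableEq β] (s : Finset β) (p : β → Prop)
    [DecidablePred p] : #{x : {e : β // e ∈ s} | p x.1} = #{x ∈ s | p x} := by
  rw [← card_map (Function.Embedding.subtype _)]
  congr 1
  ext x
  simp only [mem_map, mem_filter, mem_univ, true_and]
  constructor
  · rintro ⟨a, ha, rfl⟩; exact ⟨a.2, ha⟩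
  · rintro ⟨h1, h2⟩; exact ⟨⟨x, h1⟩, h2, rfl⟩

theorem choose_aux (a b : ℕ) (N M : ℕ)
    (hh : (a + b + 1) * (a + b).choose a * N = M) :
    (a + 1 : ℝ) * N = M * (1 / ((a + 1 + b).choose (a + 1) : ℝ)) := by
  have h1 := Nat.add_one_mul_choose_eq (a + b) a
  have h2 : ((a + b + 1 : ℕ) : ℝ) * ((a + b).choose a : ℝ) =
    ((a + b + 1).choose (a + 1) : ℝ) * (a + 1) := by exact_mod_cast h1
  have h3 : a + 1 + b = a + b + 1 := by ring
  have h4 : ((a + b + 1).choose (a + 1) : ℝ) ≠ 0 := by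
    have := Nat.choose_pos (show a + 1 ≤ a + b + 1 by omega)
    positivity
  have hh' : ((a + b + 1 : ℕ) : ℝ) * ((a + b).choose a : ℝ) * N = M := by exact_mod_cast hh
  rw [h3, ← hh', h2]
  field_simp

open Classical in
theorem count_F {V : Type*} [Fintype V] [DecidableEq V] [Nonempty V]
    (s F : Finset (Sym2 V)) (hs : ∀ e ∈ s, ¬ e.IsDiag) (hF : F ⊆ s) (d δ : ℕ) (hδ : 1 ≤ δ)
    (hsd : ∀ v, degIn s v = d) (hFd : ∀ v, degIn F v = δ) :
    (#{ω : Fin s.card ≃ {e : Sym2 V // e ∈ s} | F ⊆ finalEdges δ ω} : ℝ) =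
    Fintype.card (Fin s.card ≃ {e : Sym2 V // e ∈ s}) *
      (2 / ((#F + (d - δ)).choose #F : ℝ) - 1 / ((#F + 2 * (d - δ)).choose #F : ℝ)) := by
  set M := Fintype.card (Fin s.card ≃ {e : Sym2 V // e ∈ s}) with hM
  have hFpos : 0 < #F := by
    obtain ⟨v⟩ := ‹Nonempty V›
    have h1 : 0 < degIn F v := by rw [hFd]; omega
    exact h1.trans_le (card_le_card (filter_subset _ _))
  obtain ⟨a, ha⟩ : ∃ a, #F = a + 1 := ⟨#F - 1, by omega⟩
  let F' : Finset {e : Sym2 V // e ∈ s} := {x | x.1 ∈ F}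
  have cF' : #F' = a + 1 := by
    change #({x | x.1 ∈ F} : Finset {e : Sym2 V // e ∈ s}) = a + 1
    rw [card_subtype_filter s (fun x => x ∈ F), ← ha]
    congr 1
    ext x; simp only [mem_filter]; exact ⟨fun h => h.2, fun h => ⟨hF h, h⟩⟩
  have cB : ∀ v, #(evB s F v) = d - δ := by
    intro v
    rw [evB, card_subtype_filter s (fun x => v ∈ x ∧ x ∉ F), ← hsd v, ← hFd v, degIn, degIn,
      ← card_sdiff_of_subset (filter_subset_filter _ hF)]
    congr 1
    ext x; simp only [mem_filter, mem_sdiff]; tauto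
  have cA : ∀ e ∈ F', #(evA s F e) = a := by
    intro e he
    have : evA s F e = F'.erase e := by
      ext x; simp only [evA, F', mem_filter, mem_univ, true_and, mem_erase]; tauto
    rw [this, card_erase_of_mem he, cF']; rfl
  have hset : ({ω : Fin s.card ≃ {e : Sym2 V // e ∈ s} | F ⊆ finalEdges δ ω} : Finset _) =
      F'.biUnion (fun e => {ω | ∃ v ∈ e.1, ev (evA s F e) e (evB s F v) ω}) := by
    ext ω
    rw [mem_filter, subset_final_iff s F hF δ hδ hFd]
    simp [F']
  have hdisj : ∀ e ∈ F', ∀ e' ∈ F', e ≠ e' → Disjoint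
      ({ω | ∃ v ∈ e.1, ev (evA s F e) e (evB s F v) ω} : Finset (Fin s.card ≃ {e : Sym2 V // e ∈ s}))
      ({ω | ∃ v ∈ e'.1, ev (evA s F e') e' (evB s F v) ω} : Finset (Fin s.card ≃ {e : Sym2 V // e ∈ s})) := by
    intro e he e' he' hne
    rw [Finset.disjoint_left]
    intro ω h1 h2
    rw [mem_filter] at h1 h2
    obtain ⟨-, v, -, h1, -⟩ := h1
    obtain ⟨-, w, -, h2, -⟩ := h2
    simp only [F', mem_filter, mem_univ, true_and] at he he'
    have h3 := h1 e' (by simp only [evA, mem_filter, mem_univ, true_and]; exact ⟨he', hne.symm⟩)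
    have h4 := h2 e (by simp only [evA, mem_filter, mem_univ, true_and]; exact ⟨he, hne⟩)
    exact absurd h3 (not_lt.2 h4.le)
  have hone : ∀ e ∈ F', (a + 1 : ℝ) * (#({ω | ∃ v ∈ e.1, ev (evA s F e) e (evB s F v) ω} :
      Finset (Fin s.card ≃ {e : Sym2 V // e ∈ s})) : ℝ) =
      M * (2 / ((#F + (d - δ)).choose #F : ℝ) - 1 / ((#F + 2 * (d - δ)).choose #F : ℝ)) := by
    intro e he
    have heF : e.1 ∈ F := by simpa [F'] using he
    obtain ⟨u, v, huv⟩ : ∃ u v, e.1 = s(u, v) := by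
      obtain ⟨x, hx⟩ := e
      induction x using Sym2.ind with
      | _ u v => exact ⟨u, v, rfl⟩
    have hne : u ≠ v := by
      intro h
      apply hs e.1 e.2
      rw [huv, h]; simp
    have hAB : ∀ w, Disjoint (evA s F e) (evB s F w) := by
      intro w
      rw [Finset.disjoint_left]
      intro x h1 h2
      simp only [evA, evB, mem_filter, mem_univ, true_and] at h1 h2
      exact h2.2 h1.1
    have heA : e ∉ evA s F e := by simp [evA]
    have heB : ∀ w, e ∉ evB s F w := by intro w; simp [evB, heF]
    have hBB : Disjoint (evB s F u) (evB s F v) := by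
      rw [Finset.disjoint_left]
      intro x h1 h2
      simp only [evB, mem_filter, mem_univ, true_and] at h1 h2
      have : x.1 = s(u, v) := (Sym2.mem_and_mem_iff hne).1 ⟨h1.1, h2.1⟩
      rw [this, ← huv] at h1
      exact h1.2 heF
    have hsplit : ({ω | ∃ v ∈ e.1, ev (evA s F e) e (evB s F v) ω} :
        Finset (Fin s.card ≃ {e : Sym2 V // e ∈ s})) =
        ({ω | ev (evA s F e) e (evB s F u) ω} : Finset _) ∪
        ({ω | ev (evA s F e) e (evB s F v) ω} : Finset _) := by
      ext ω
      rw [mem_union, mem_filter, mem_filter, mem_filter, huv]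
      simp
    have hint : ({ω | ev (evA s F e) e (evB s F u) ω} : Finset (Fin s.card ≃ {e : Sym2 V // e ∈ s})) ∩
        ({ω | ev (evA s F e) e (evB s F v) ω} : Finset _) =
        ({ω | ev (evA s F e) e (evB s F u ∪ evB s F v) ω} : Finset _) := by
      ext ω
      rw [mem_inter, mem_filter, mem_filter, mem_filter]
      simp only [mem_univ, true_and, ev, mem_union]
      constructor
      · rintro ⟨⟨h1, h2⟩, h3, h4⟩
        exact ⟨h1, fun y hy => hy.elim (h2 y) (h4 y)⟩
      · rintro ⟨h1, h2⟩
        exact ⟨⟨h1, fun y hy => h2 y (Or.inl hy)⟩, h1, fun y hy => h2 y (Or.inr hy)⟩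
    have hcu := card_union_add_card_inter
      ({ω | ev (evA s F e) e (evB s F u) ω} : Finset (Fin s.card ≃ {e : Sym2 V // e ∈ s}))
      ({ω | ev (evA s F e) e (evB s F v) ω} : Finset _)
    rw [← hsplit, hint] at hcu
    have c1 := ev_count (m := s.card) _ _ e (hAB u) heA (heB u)
    have c2 := ev_count (m := s.card) _ _ e (hAB v) heA (heB v)
    have c3 := ev_count (m := s.card) (evA s F e) (evB s F u ∪ evB s F v) e
      (by rw [disjoint_union_right]; exact ⟨hAB u, hAB v⟩) heA
      (by rw [mem_union]; exact fun h => h.elim (heB u) (heB v))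
    rw [card_union_of_disjoint hBB] at c3
    simp only [cA e he, cB, ← two_mul] at c1 c2 c3
    have d1 := choose_aux _ _ _ M c1
    have d2 := choose_aux _ _ _ M c2
    have d3 := choose_aux _ _ _ M c3
    have hcu' := congrArg (Nat.cast (R := ℝ)) hcu
    push_cast at hcu'
    rw [ha, ← sub_eq_iff_eq_add.2 hcu'.symm]
    rw [mul_sub, mul_add, d1, d2, d3]
    ring
  rw [hset, card_biUnion hdisj]
  have hpos : (a + 1 : ℝ) ≠ 0 := by positivity
  apply mul_left_cancel₀ hpos
  push_cast
  rw [Finset.mul_sum, Finset.sum_congr rfl hone, Finset.sum_const, cF', nsmul_eq_mul]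
  push_cast
  rfl

/-- Let `G` be a `d`-regular finite simple graph and `H` a `δ`-regular graph on the same
vertex set, `δ ≥ 1`, with `h` edges; set `Δ = d − δ`.  Assume `G` contains a spanning
subgraph isomorphic to `H`.  Then the expectation, over a uniformly random ordering `ω`
of the edges of `G`, of the fraction of spanning subgraphs of `G` isomorphic to `H` that
are contained in `G_ω`, equals `2/C(h+Δ,h) − 1/C(h+2Δ,h)`. -/
theorem expected_fraction_of_copies_regular
    {V : Type*} [Fintype V] [DecidableEq V]
    (G H : SimpleGraph V) [DecidableRel G.Adj] [DecidableRel H.Adj]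
    (d δ : ℕ) (hδ : 1 ≤ δ)
    (hG : G.IsRegularOfDegree d) (hH : H.IsRegularOfDegree δ)
    (hex : ∃ J : SimpleGraph V, J ≤ G ∧ Nonempty (J ≃g H))
    (h Δ : ℕ) (hh : h = H.edgeFinset.card) (hΔ : Δ = d - δ) :
    (∑ ω : Fin G.edgeFinset.card ≃ {e : Sym2 V // e ∈ G.edgeFinset},
        (({J : SimpleGraph V | J ≤ G ∧ Nonempty (J ≃g H) ∧
              J.edgeSet ⊆ ↑(finalEdges δ ω)}.ncard : ℝ) /
          ({J : SimpleGraph V | J ≤ G ∧ Nonempty (J ≃g H)}.ncard : ℝ))) /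
      (Fintype.card (Fin G.edgeFinset.card ≃ {e : Sym2 V // e ∈ G.edgeFinset}) : ℝ) =
    2 / ((h + Δ).choose h : ℝ) - 1 / ((h + 2 * Δ).choose h : ℝ) := by
  classical
  rcases isEmpty_or_nonempty V with hV | hV
  · have h0 : h = 0 := by
      rw [hh, Finset.card_eq_zero]
      apply Finset.eq_empty_of_forall_notMem
      intro x
      induction x using Sym2.ind with
      | _ u v => exact hV.elim u
    have hsing : ∀ J : SimpleGraph V, J ≤ G ∧ Nonempty (J ≃g H) := by
      intro J
      obtain ⟨J', hJ'⟩ := hex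
      rw [Subsingleton.elim J J']; exact hJ'
    have hedge : ∀ (J : SimpleGraph V) (S : Set (Sym2 V)), J.edgeSet ⊆ S := by
      intro J S x
      induction x using Sym2.ind with
      | _ u v => exact hV.elim u
    have e1 : ∀ ω : Fin G.edgeFinset.card ≃ {e : Sym2 V // e ∈ G.edgeFinset},
        {J : SimpleGraph V | J ≤ G ∧ Nonempty (J ≃g H) ∧
              J.edgeSet ⊆ ↑(finalEdges δ ω)} = {J : SimpleGraph V | J ≤ G ∧ Nonempty (J ≃g H)} := by
      intro ω
      ext J
      simp only [Set.mem_setOf_eq]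
      exact ⟨fun h => ⟨h.1, h.2.1⟩, fun h => ⟨h.1, h.2, hedge _ _⟩⟩
    have hn : (({J : SimpleGraph V | J ≤ G ∧ Nonempty (J ≃g H)}.ncard : ℕ) : ℝ) ≠ 0 := by
      obtain ⟨J, hJ⟩ := hex
      exact_mod_cast Set.ncard_ne_zero_of_mem (a := J) hJ
    have hc : (Fintype.card (Fin G.edgeFinset.card ≃ {e : Sym2 V // e ∈ G.edgeFinset}) : ℝ) ≠ 0 := by
      have : Nonempty (Fin G.edgeFinset.card ≃ {e : Sym2 V // e ∈ G.edgeFinset}) :=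
        ⟨G.edgeFinset.equivFin.symm⟩
      exact_mod_cast Fintype.card_ne_zero
    simp only [e1, div_self hn]
    rw [Finset.sum_const, Finset.card_univ, nsmul_eq_mul, mul_one, div_self hc, h0]
    norm_num
  · have degE : ∀ (J : SimpleGraph V) (v : V), degIn J.edgeFinset v = J.degree v := by
      intro J v
      rw [← SimpleGraph.card_incidenceFinset_eq_degree, SimpleGraph.incidenceFinset_eq_filter, degIn]
    have hJc : ∀ J : SimpleGraph V, J ≤ G ∧ Nonempty (J ≃g H) →
        ((#{ω : Fin G.edgeFinset.card ≃ {e : Sym2 V // e ∈ G.edgeFinset} |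
          J.edgeSet ⊆ ↑(finalEdges δ ω)} : ℕ) : ℝ) =
        Fintype.card (Fin G.edgeFinset.card ≃ {e : Sym2 V // e ∈ G.edgeFinset}) *
          (2 / ((h + Δ).choose h : ℝ) - 1 / ((h + 2 * Δ).choose h : ℝ)) := by
      rintro J ⟨hJG, ⟨φ⟩⟩
      have hcard : #J.edgeFinset = h := by
        rw [hh]; exact φ.card_edgeFinset_eq
      have := count_F G.edgeFinset J.edgeFinset
        (fun e he => G.not_isDiag_of_mem_edgeFinset he)
        (by rw [SimpleGraph.edgeFinset_subset_edgeFinset]; exact hJG) d δ hδ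
        (by
          intro v
          have h1 := hG v
          rw [← h1, ← SimpleGraph.card_incidenceFinset_eq_degree,
            SimpleGraph.incidenceFinset_eq_filter, degIn])
        (by
          intro v
          rw [degE, ← hH (φ v)]
          exact (φ.degree_eq v).symm)
      rw [hcard, ← hΔ] at this
      rw [← this]
      congr 2
      ext ω
      rw [mem_filter, mem_filter, ← Finset.coe_subset, SimpleGraph.coe_edgeFinset]
    let P : Finset (SimpleGraph V) := {J | J ≤ G ∧ Nonempty (J ≃g H)}
    have hP : {J : SimpleGraph V | J ≤ G ∧ Nonempty (J ≃g H)}.ncard = #P := by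
      rw [← Set.ncard_coe_finset]; simp [P]
    have hPw : ∀ ω : Fin G.edgeFinset.card ≃ {e : Sym2 V // e ∈ G.edgeFinset},
        {J : SimpleGraph V | J ≤ G ∧ Nonempty (J ≃g H) ∧
              J.edgeSet ⊆ ↑(finalEdges δ ω)}.ncard =
        ∑ J ∈ P, if J.edgeSet ⊆ ↑(finalEdges δ ω) then 1 else 0 := by
      intro ω
      rw [← Finset.card_filter, ← Set.ncard_coe_finset]
      congr 1
      ext J
      simp [P, and_assoc]
    have hP0 : (#P : ℝ) ≠ 0 := by
      obtain ⟨J, hJ⟩ := hex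
      have : J ∈ P := by simpa [P] using hJ
      exact_mod_cast (Finset.card_pos.2 ⟨J, this⟩).ne'
    have hc : (Fintype.card (Fin G.edgeFinset.card ≃ {e : Sym2 V // e ∈ G.edgeFinset}) : ℝ) ≠ 0 := by
      have : Nonempty (Fin G.edgeFinset.card ≃ {e : Sym2 V // e ∈ G.edgeFinset}) :=
        ⟨G.edgeFinset.equivFin.symm⟩
      exact_mod_cast Fintype.card_ne_zero
    rw [← Finset.sum_div, hP, ← Nat.cast_sum, Finset.sum_congr rfl (fun ω _ => hPw ω),
      Finset.sum_comm]
    simp only [← Finset.card_filter]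
    rw [Nat.cast_sum, Finset.sum_congr rfl (fun J hJ => hJc J (by simpa [P] using hJ)),
      Finset.sum_const, nsmul_eq_mul]
    field_simp
end

section
/- With V the vertex set of the complete r-partite graph K_{n,…,n} (parts of size n), E the set of all n^r transversal r-element subsets of V, and G_ω the random r-uniform hypergraph obtained by taking a uniformly random ordering of E and stopping as soon as every vertex is covered, the expected number of matchings contained in G_ω equals (n!)^{r−1} · Σ_{i=1}^{r} (−1)^{i−1} · binom(r, i) / binom(n^r − (n−1)^i · n^{r−i} + n − 1, n). -/
open Finset

/-- The degree of a vertex `v` in the hypergraph whose edge set is the finite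
set `s` of edges (finite subsets of `V`). -/
def hDegIn {V : Type*} [DecidableEq V] (s : Finset (Finset V)) (v : V) : ℕ :=
  (s.filter (fun e => v ∈ e)).card

/-- Given an ordering `ω` of a finite set `s` of hyperedges, the set consisting of
the first `i` edges `e_{ω(1)}, …, e_{ω(i)}`. -/
def hPrefix {V : Type*} [DecidableEq V] {s : Finset (Finset V)}
    (ω : Fin s.card ≃ {e : Finset V // e ∈ s}) (i : ℕ) : Finset (Finset V) :=
  (Finset.univ.filter (fun j : Fin s.card => (j : ℕ) < i)).image (fun j => (ω j : Finset V))

/-- `k(ω)`: the least `i` such that every vertex is covered by one of the first `i`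
edges of the ordering `ω`. -/
noncomputable def hStop {V : Type*} [Fintype V] [DecidableEq V]
    {s : Finset (Finset V)} (ω : Fin s.card ≃ {e : Finset V // e ∈ s}) : ℕ :=
  sInf {i | ∀ v : V, ∃ e ∈ hPrefix ω i, v ∈ e}

/-- The edge set of the hypergraph `G_ω`: the first `k(ω)` edges of the ordering `ω`. -/
noncomputable def hFinal {V : Type*} [Fintype V] [DecidableEq V]
    {s : Finset (Finset V)} (ω : Fin s.card ≃ {e : Finset V // e ∈ s}) : Finset (Finset V) :=
  hPrefix ω (hStop ω)

/-- `M` is a matching covering `V`: every vertex lies in exactly one member of `M`. -/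
def hIsMatching {V : Type*} (M : Finset (Finset V)) : Prop :=
  ∀ v : V, ∃! e, e ∈ M ∧ v ∈ e

/-- The transversal edges of the complete `r`-partite graph `K_{n,…,n}` with vertex set
`Fin r × Fin n` (part `V_i = {i} × Fin n`): the subsets containing exactly one vertex
from each part. -/
def transversals (r n : ℕ) : Finset (Finset (Fin r × Fin n)) :=
  Finset.univ.filter (fun e => ∀ i : Fin r, (e.filter (fun x => x.1 = i)).card = 1)

section aux
variable {α β : Type*} [Fintype α] [DecidableEq α] [Fintype β] [LinearOrder β]

lemma aux_last (A : Finset α) (e : α) (he : e ∉ A) :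
    (univ.filter (fun ω : β ≃ α => ∀ a ∈ A, ω.symm a < ω.symm e)).card * (A.card + 1)
      = Fintype.card (β ≃ α) := by
  classical
  set F : α → Finset (β ≃ α) := fun x =>
    univ.filter (fun ω : β ≃ α => ∀ a ∈ insert e A, a ≠ x → ω.symm a < ω.symm x) with hF
  have h1 : ((insert e A).biUnion F) = univ := by
    ext ω
    simp only [mem_biUnion, mem_univ, iff_true]
    obtain ⟨x, hx, hm⟩ := exists_max_image (insert e A) (fun a => ω.symm a) (insert_nonempty _ _)
    refine ⟨x, hx, ?_⟩
    simp only [hF, mem_filter, mem_univ, true_and]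
    intro a ha hne
    exact lt_of_le_of_ne (hm a ha) (fun h => hne (ω.symm.injective h))
  have h2 : ((insert e A).biUnion F).card = ∑ x ∈ insert e A, (F x).card := by
    apply card_biUnion
    intro x hx y hy hxy
    rw [Function.onFun, Finset.disjoint_left]
    intro ω h h'
    simp only [hF, mem_filter, mem_univ, true_and] at h h'
    exact lt_asymm (h y hy hxy.symm) (h' x hx hxy)
  have h3 : ∀ x ∈ insert e A, (F x).card = (F e).card := by
    intro x hx
    refine card_bij' (fun ω _ => ω.trans (Equiv.swap x e))
      (fun ω _ => ω.trans (Equiv.swap x e)) ?_ ?_ ?_ ?_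
    · intro ω hω
      simp only [hF, mem_filter, mem_univ, true_and] at hω ⊢
      intro a ha hne
      simp only [Equiv.symm_trans_apply, Equiv.symm_swap, Equiv.swap_apply_right]
      apply hω
      · rcases eq_or_ne a x with h | h
        · subst h; simp
        · rw [Equiv.swap_apply_of_ne_of_ne h hne]; exact ha
      · intro h
        apply hne
        rw [Equiv.swap_apply_eq_iff] at h
        simpa using h
    · intro ω hω
      simp only [hF, mem_filter, mem_univ, true_and] at hω ⊢
      intro a ha hne
      simp only [Equiv.symm_trans_apply, Equiv.symm_swap, Equiv.swap_apply_left]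
      apply hω
      · rcases eq_or_ne a e with h | h
        · subst h; simpa using hx
        · rw [Equiv.swap_apply_of_ne_of_ne hne h]; exact ha
      · intro h
        apply hne
        rw [Equiv.swap_apply_eq_iff] at h
        simpa using h
    · intro ω _; ext; simp
    · intro ω _; ext; simp
  rw [h1, sum_congr rfl h3, sum_const, card_insert_of_notMem he, card_univ, smul_eq_mul] at h2
  rw [h2, mul_comm]
  congr 2
  ext ω
  simp only [hF, mem_filter, mem_univ, true_and, mem_insert, forall_eq_or_imp]
  constructor
  · intro h
    exact ⟨fun h => absurd rfl h, fun a ha _ => h a ha⟩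
  · rintro ⟨-, h⟩ a ha
    exact h a ha (fun h => he (h ▸ ha))

lemma aux_event (B : Finset α) : ∀ (A : Finset α) (e : α), e ∉ A → e ∉ B → Disjoint A B →
    ((univ.filter (fun ω : β ≃ α => (∀ a ∈ A, ω.symm a < ω.symm e) ∧
      ∀ b ∈ B, ω.symm e < ω.symm b)).card : ℝ)
      = Fintype.card (β ≃ α) * ((A.card.factorial * B.card.factorial : ℝ) /
        ((A.card + B.card + 1).factorial : ℝ)) := by
  classical
  induction B using Finset.induction_on with
  | empty =>
    intro A e hA _ _
    have := aux_last (β := β) A e hA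
    simp only [notMem_empty, false_imp_iff, implies_true, and_true, card_empty, Nat.factorial_zero,
      Nat.cast_one, mul_one, add_zero]
    rw [← this, Nat.factorial_succ]
    have := Nat.factorial_ne_zero A.card
    push_cast
    field_simp
  | insert x B hx ih =>
    intro A e hA hB hAB
    rw [mem_insert, not_or] at hB
    rw [disjoint_insert_right] at hAB
    have i1 := ih A e hA hB.2 hAB.2
    have i2 := ih (insert x A) e (by simp [hA, hB.1]) hB.2 (by
      rw [disjoint_insert_left]; exact ⟨hx, hAB.2⟩)
    have key : (univ.filter (fun ω : β ≃ α => (∀ a ∈ A, ω.symm a < ω.symm e) ∧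
        ∀ b ∈ B, ω.symm e < ω.symm b)).card =
      (univ.filter (fun ω : β ≃ α => (∀ a ∈ insert x A, ω.symm a < ω.symm e) ∧
        ∀ b ∈ B, ω.symm e < ω.symm b)).card +
      (univ.filter (fun ω : β ≃ α => (∀ a ∈ A, ω.symm a < ω.symm e) ∧
        ∀ b ∈ insert x B, ω.symm e < ω.symm b)).card := by
      rw [← card_union_of_disjoint]
      · congr 1
        ext ω
        simp only [mem_filter, mem_univ, true_and, mem_union, mem_insert, forall_eq_or_imp]
        have : ω.symm x ≠ ω.symm e := fun h => hB.1 (ω.symm.injective h).symm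
        rcases lt_or_gt_of_ne this with h | h <;> tauto
      · rw [Finset.disjoint_left]
        intro ω h h'
        simp only [mem_filter, mem_univ, true_and, mem_insert, forall_eq_or_imp] at h h'
        exact lt_asymm h.1.1 h'.2.1
    have key' := congrArg (Nat.cast : ℕ → ℝ) key
    rw [Nat.cast_add, i1, i2] at key'
    rw [← sub_eq_iff_eq_add'] at key'
    rw [← key', card_insert_of_notMem hx, card_insert_of_notMem hAB.1, ← mul_sub]
    congr 1
    rw [show A.card + 1 + B.card + 1 = (A.card + B.card + 1) + 1 by ring,
      show A.card + (B.card + 1) + 1 = (A.card + B.card + 1) + 1 by ring,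
      Nat.factorial_succ (A.card + B.card + 1), Nat.factorial_succ A.card,
      Nat.factorial_succ B.card]
    have := Nat.factorial_ne_zero (A.card + B.card + 1)
    push_cast
    field_simp
    ring

end aux

/-- Matchings, in terms of functions. -/
def auxIsM {r n : ℕ} (M : Finset (Fin r → Fin n)) : Prop :=
  ∀ (i : Fin r) (x : Fin n), ∃! g, g ∈ M ∧ g i = x

lemma auxB_card {r n : ℕ} (e : Fin r → Fin n) (t : Finset (Fin r)) (ht : t.Nonempty) :
    (univ.filter (fun f : Fin r → Fin n => f ≠ e ∧ ∃ i ∈ t, f i = e i)).card + 1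
      = n ^ r - (n - 1) ^ t.card * n ^ (r - t.card) := by
  classical
  have h1 : (univ.filter (fun f : Fin r → Fin n => ∀ i ∈ t, f i ≠ e i)).card
      = (n - 1) ^ t.card * n ^ (r - t.card) := by
    have : univ.filter (fun f : Fin r → Fin n => ∀ i ∈ t, f i ≠ e i)
        = Fintype.piFinset (fun i => if i ∈ t then univ.erase (e i) else univ) := by
      ext f
      simp only [mem_filter, mem_univ, true_and, Fintype.mem_piFinset]
      apply forall_congr'
      intro i
      by_cases h : i ∈ t <;> simp [h]
    rw [this, Fintype.card_piFinset]
    have h2 : ∀ i : Fin r, (if i ∈ t then univ.erase (e i) else (univ : Finset (Fin n))).card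
        = if i ∈ t then n - 1 else n := by
      intro i
      by_cases h : i ∈ t <;> simp [h]
    rw [prod_congr rfl (fun i _ => h2 i), prod_ite]
    simp only [prod_const]
    congr 2
    · simp
    · rw [filter_not, card_sdiff_of_subset (filter_subset _ _)]
      simp
  have h3 := card_filter_add_card_filter_not (s := (univ : Finset (Fin r → Fin n)))
    (fun f : Fin r → Fin n => ∀ i ∈ t, f i ≠ e i)
  rw [h1, card_univ, Fintype.card_fun, Fintype.card_fin, Fintype.card_fin] at h3
  have h4 : univ.filter (fun f : Fin r → Fin n => ¬ ∀ i ∈ t, f i ≠ e i)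
      = insert e (univ.filter (fun f : Fin r → Fin n => f ≠ e ∧ ∃ i ∈ t, f i = e i)) := by
    ext f
    simp only [mem_filter, mem_univ, true_and, mem_insert]
    push Not
    constructor
    · intro h
      by_cases hf : f = e
      · exact Or.inl hf
      · exact Or.inr ⟨hf, h⟩
    · rintro (h | h)
      · subst h
        obtain ⟨i, hi⟩ := ht
        exact ⟨i, hi, rfl⟩
      · exact h.2
  rw [h4, card_insert_of_notMem (by simp)] at h3
  omega

lemma auxM_card {r n : ℕ} (hr : 0 < r) (M : Finset (Fin r → Fin n)) (hM : auxIsM M) :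
    M.card = n := by
  classical
  have : M.card = (univ : Finset (Fin n)).card := by
    refine card_bij (fun g _ => g ⟨0, hr⟩) (fun _ _ => mem_univ _) ?_ ?_
    · intro a ha b hb h
      exact (hM ⟨0, hr⟩ (b ⟨0, hr⟩)).unique ⟨ha, h⟩ ⟨hb, rfl⟩
    · intro x _
      obtain ⟨g, hg, -⟩ := hM ⟨0, hr⟩ x
      exact ⟨g, hg.1, hg.2⟩
  simpa using this

lemma auxM_one {β : Type*} [Fintype β] [LinearOrder β] {r n : ℕ} (hr : 0 < r)
    (M : Finset (Fin r → Fin n)) (hM : auxIsM M) (e : Fin r → Fin n) (he : e ∈ M) :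
    ((univ.filter (fun ω : β ≃ (Fin r → Fin n) => (∀ a ∈ M.erase e, ω.symm a < ω.symm e) ∧
      ∃ i : Fin r, ∀ f, f ≠ e → f i = e i → ω.symm e < ω.symm f)).card : ℝ)
    = Fintype.card (β ≃ (Fin r → Fin n)) * ∑ i ∈ Icc 1 r, (-1 : ℝ) ^ (i - 1) * (r.choose i : ℝ) *
      (((n - 1).factorial * (n ^ r - (n - 1) ^ i * n ^ (r - i) - 1).factorial : ℝ) /
        ((n - 1 + (n ^ r - (n - 1) ^ i * n ^ (r - i) - 1) + 1).factorial : ℝ)) := by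
  classical
  set S : Fin r → Finset (β ≃ (Fin r → Fin n)) := fun i =>
    univ.filter (fun ω => (∀ a ∈ M.erase e, ω.symm a < ω.symm e) ∧
      ∀ f, f ≠ e → f i = e i → ω.symm e < ω.symm f) with hS
  have h1 : univ.filter (fun ω : β ≃ (Fin r → Fin n) => (∀ a ∈ M.erase e, ω.symm a < ω.symm e) ∧
      ∃ i : Fin r, ∀ f, f ≠ e → f i = e i → ω.symm e < ω.symm f) = univ.biUnion S := by
    ext ω
    simp [hS]
  set c : ℕ → ℝ := fun i => Fintype.card (β ≃ (Fin r → Fin n)) *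
    (((n - 1).factorial * (n ^ r - (n - 1) ^ i * n ^ (r - i) - 1).factorial : ℝ) /
        ((n - 1 + (n ^ r - (n - 1) ^ i * n ^ (r - i) - 1) + 1).factorial : ℝ)) with hc
  have h2 : ∀ (t : Finset (Fin r)) (ht : t.Nonempty), ((t.inf' ht S).card : ℝ) = c t.card := by
    intro t ht
    have hE : t.inf' ht S = univ.filter (fun ω : β ≃ (Fin r → Fin n) =>
        (∀ a ∈ M.erase e, ω.symm a < ω.symm e) ∧
        ∀ b ∈ univ.filter (fun f : Fin r → Fin n => f ≠ e ∧ ∃ i ∈ t, f i = e i),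
          ω.symm e < ω.symm b) := by
      ext ω
      rw [inf'_eq_inf, mem_inf]
      simp only [hS, mem_filter, mem_univ, true_and]
      constructor
      · intro h
        refine ⟨?_, ?_⟩
        · obtain ⟨i, hi⟩ := ht
          exact (h i hi).1
        · rintro f ⟨hf, i, hi, hfi⟩
          exact (h i hi).2 f hf hfi
      · rintro ⟨h, h'⟩ i hi
        exact ⟨h, fun f hf hfi => h' f ⟨hf, i, hi, hfi⟩⟩
    rw [hE, aux_event _ _ _ (by simp) (by simp)]
    · have hb := auxB_card e t ht
      have hb' := Nat.eq_sub_of_add_eq hb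
      rw [hb', card_erase_of_mem he, auxM_card hr M hM]
    · rw [Finset.disjoint_left]
      intro a ha hb
      simp only [mem_filter, mem_univ, true_and, mem_erase] at ha hb
      obtain ⟨hne, i, -, hi⟩ := hb
      exact hne ((hM i (e i)).unique ⟨ha.2, hi⟩ ⟨he, rfl⟩)
  have h3 := congrArg (Int.cast : ℤ → ℝ)
    (inclusion_exclusion_card_biUnion (univ : Finset (Fin r)) S)
  push_cast at h3
  rw [h1, h3, sum_congr rfl (g := fun t : {t // t ∈ (univ : Finset (Fin r)).powerset.filter (·.Nonempty)} =>
    (fun t : Finset (Fin r) => (-1 : ℝ) ^ (t.card + 1) * c t.card) t.1)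
    (fun t _ => by rw [h2 t.1 (mem_filter.1 t.2).2]),
    sum_coe_sort ((univ : Finset (Fin r)).powerset.filter (·.Nonempty))
      (fun t : Finset (Fin r) => (-1 : ℝ) ^ (t.card + 1) * c t.card), sum_filter,
    sum_congr rfl (g := fun t : Finset (Fin r) =>
      (fun k : ℕ => if 0 < k then (-1 : ℝ) ^ (k + 1) * c k else 0) t.card)
      (fun t _ => by simp only [card_pos]), sum_powerset_apply_card
        (fun k : ℕ => if 0 < k then (-1 : ℝ) ^ (k + 1) * c k else 0), card_univ, Fintype.card_fin,
    mul_sum]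
  have hI : Icc 1 r = (range (r + 1)).filter (fun k => 0 < k) := by
    ext k; simp only [mem_Icc, mem_filter, mem_range]; omega
  rw [hI, sum_filter]
  apply sum_congr rfl
  intro k _
  split_ifs with hk
  · obtain ⟨j, rfl⟩ : ∃ j, k = j + 1 := ⟨k - 1, by omega⟩
    simp only [hc, nsmul_eq_mul, Nat.add_sub_cancel, pow_succ (-1 : ℝ)]
    ring
  · simp

/-- The number of orderings in which a given matching is good. -/
lemma auxM_total {β : Type*} [Fintype β] [LinearOrder β] {r n : ℕ} (hr : 0 < r) (hn : 1 ≤ n)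
    (M : Finset (Fin r → Fin n)) (hM : auxIsM M) :
    ((univ.filter (fun ω : β ≃ (Fin r → Fin n) => ∃ e ∈ M,
      (∀ a ∈ M.erase e, ω.symm a < ω.symm e) ∧
      ∃ i : Fin r, ∀ f, f ≠ e → f i = e i → ω.symm e < ω.symm f)).card : ℝ)
    = Fintype.card (β ≃ (Fin r → Fin n)) * ∑ i ∈ Icc 1 r, (-1 : ℝ) ^ (i - 1) * (r.choose i : ℝ) /
        ((n ^ r - (n - 1) ^ i * n ^ (r - i) + n - 1).choose n : ℝ) := by
  classical
  have h1 : univ.filter (fun ω : β ≃ (Fin r → Fin n) => ∃ e ∈ M,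
      (∀ a ∈ M.erase e, ω.symm a < ω.symm e) ∧
      ∃ i : Fin r, ∀ f, f ≠ e → f i = e i → ω.symm e < ω.symm f)
      = M.biUnion (fun e => univ.filter (fun ω : β ≃ (Fin r → Fin n) =>
        (∀ a ∈ M.erase e, ω.symm a < ω.symm e) ∧
        ∃ i : Fin r, ∀ f, f ≠ e → f i = e i → ω.symm e < ω.symm f)) := by
    ext ω
    simp only [mem_filter, mem_univ, true_and, mem_biUnion]
  rw [h1, card_biUnion]
  · push_cast
    rw [sum_congr rfl (fun e he => auxM_one hr M hM e he), sum_const, auxM_card hr M hM,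
      nsmul_eq_mul, mul_left_comm]
    congr 1
    rw [mul_sum]
    apply sum_congr rfl
    intro i hi
    rw [mem_Icc] at hi
    have hD : 1 ≤ n ^ r - (n - 1) ^ i * n ^ (r - i) := by
      have h1 : (n - 1) ^ i * n ^ (r - i) < n ^ r := by
        calc (n - 1) ^ i * n ^ (r - i) < n ^ i * n ^ (r - i) := by
              apply Nat.mul_lt_mul_of_pos_right
              · exact Nat.pow_lt_pow_left (by omega) (by omega)
              · positivity
          _ = n ^ r := by rw [← pow_add]; congr 1; omega
      omega
    generalize n ^ r - (n - 1) ^ i * n ^ (r - i) = D at hD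
    obtain ⟨d, rfl⟩ : ∃ d, D = d + 1 := ⟨D - 1, by omega⟩
    obtain ⟨m, rfl⟩ : ∃ m, n = m + 1 := ⟨n - 1, by omega⟩
    have hch := Nat.add_choose_mul_factorial_mul_factorial d (m + 1)
    have e1 : d + 1 + (m + 1) - 1 = d + (m + 1) := by omega
    have e2 : m + 1 - 1 + (d + 1 - 1) + 1 = d + (m + 1) := by omega
    rw [e1, e2]
    have hs : (d + (m + 1)).choose d = (d + (m + 1)).choose (m + 1) := by
      rw [Nat.choose_symm_add]
    rw [← hch, ← hs]
    have hc0 : (d + (m + 1)).choose d ≠ 0 := (Nat.choose_pos (by omega)).ne'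
    have := Nat.factorial_ne_zero d
    have := Nat.factorial_ne_zero m
    rw [Nat.factorial_succ m]
    simp only [Nat.add_sub_cancel]
    push_cast
    field_simp
  · intro x hx y hy hxy
    rw [Function.onFun, Finset.disjoint_left]
    intro ω h h'
    simp only [mem_filter, mem_univ, true_and, mem_erase] at h h'
    exact lt_asymm (h.1 y ⟨hxy.symm, hy⟩) (h'.1 x ⟨hxy, hx⟩)

open Classical in
lemma auxM_count {k n : ℕ} :
    (univ.filter (fun M : Finset (Fin (k + 1) → Fin n) => auxIsM M)).card = n.factorial ^ k := by
  have hp : (univ : Finset (Fin k → Equiv.Perm (Fin n))).card = n.factorial ^ k := by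
    simp [Fintype.card_perm]
  rw [← hp]
  symm
  refine card_bij (fun σ _ => univ.image
    (fun j : Fin n => (Fin.cons j (fun i => σ i j) : Fin (k + 1) → Fin n))) ?_ ?_ ?_
  · intro σ _
    simp only [mem_filter, mem_univ, true_and]
    intro i x
    refine Fin.cases ?_ (fun i => ?_) i
    · refine ⟨_, ⟨mem_image_of_mem _ (mem_univ x), by simp⟩, ?_⟩
      rintro g ⟨hg, hx⟩
      obtain ⟨j, -, rfl⟩ := mem_image.1 hg
      simp only [Fin.cons_zero] at hx
      rw [hx]
    · refine ⟨_, ⟨mem_image_of_mem _ (mem_univ ((σ i).symm x)), by simp⟩, ?_⟩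
      rintro g ⟨hg, hx⟩
      obtain ⟨j, -, rfl⟩ := mem_image.1 hg
      simp only [Fin.cons_succ] at hx
      rw [← hx]
      simp
  · intro σ _ τ _ h
    funext i
    ext j : 1
    have hm : (Fin.cons j (fun i => σ i j) : Fin (k + 1) → Fin n) ∈ univ.image
        (fun j : Fin n => (Fin.cons j (fun i => τ i j) : Fin (k + 1) → Fin n)) := by
      rw [← h]
      exact mem_image_of_mem _ (mem_univ j)
    obtain ⟨j', -, hj⟩ := mem_image.1 hm
    have h0 := congrFun hj 0
    have h1 := congrFun hj i.succ
    simp only [Fin.cons_zero, Fin.cons_succ] at h0 h1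
    rw [← h1, h0]
  · intro M hM
    simp only [mem_filter, mem_univ, true_and] at hM
    choose g hg hu using fun j => hM 0 j
    have hinj : ∀ i : Fin k, Function.Injective (fun j => g j i.succ) := by
      intro i a b hab
      have := (hM i.succ (g b i.succ)).unique ⟨(hg a).1, hab⟩ ⟨(hg b).1, rfl⟩
      rw [← (hg a).2, ← (hg b).2, this]
    refine ⟨fun i => Equiv.ofBijective _ (Finite.injective_iff_bijective.1 (hinj i)),
      mem_univ _, ?_⟩
    have hgc : ∀ j, (Fin.cons j (fun i : Fin k => g j i.succ) : Fin (k + 1) → Fin n) = g j := by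
      intro j
      funext i
      refine Fin.cases ?_ (fun i => ?_) i
      · simp [(hg j).2]
      · simp
    ext f
    simp only [mem_image, mem_univ, true_and, Equiv.ofBijective_apply, hgc]
    constructor
    · rintro ⟨j, rfl⟩
      exact (hg j).1
    · intro hf
      exact ⟨f 0, (hu (f 0) f ⟨hf, rfl⟩).symm⟩

/-- The transversal edge of a function. -/
def auxEnc {r n : ℕ} (g : Fin r → Fin n) : Finset (Fin r × Fin n) :=
  univ.image (fun i => (i, g i))

lemma auxEnc_mem {r n : ℕ} (g : Fin r → Fin n) (v : Fin r × Fin n) :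
    v ∈ auxEnc g ↔ g v.1 = v.2 := by
  obtain ⟨i, x⟩ := v
  simp [auxEnc]

lemma auxEnc_inj {r n : ℕ} : Function.Injective (auxEnc (r := r) (n := n)) := by
  intro g h hgh
  funext i
  have : (i, g i) ∈ auxEnc h := by rw [← hgh, auxEnc_mem]
  rw [auxEnc_mem] at this
  exact this.symm

lemma auxEnc_trans {r n : ℕ} (g : Fin r → Fin n) : auxEnc g ∈ transversals r n := by
  rw [transversals, mem_filter]
  refine ⟨mem_univ _, fun i => ?_⟩
  rw [card_eq_one]
  refine ⟨(i, g i), ?_⟩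
  ext ⟨j, x⟩
  simp only [mem_filter, auxEnc_mem, mem_singleton, Prod.mk.injEq]
  constructor
  · rintro ⟨h, rfl⟩
    exact ⟨rfl, h.symm⟩
  · rintro ⟨rfl, rfl⟩
    exact ⟨rfl, rfl⟩

lemma auxEnc_surj {r n : ℕ} (e : Finset (Fin r × Fin n)) (he : e ∈ transversals r n) :
    ∃ g, auxEnc g = e := by
  rw [transversals, mem_filter] at he
  have h := he.2
  simp only [card_eq_one] at h
  choose v hv using h
  have hm : ∀ i, v i ∈ e ∧ (v i).1 = i := by
    intro i
    have : v i ∈ e.filter (fun x => x.1 = i) := by rw [hv i]; simp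
    simpa using this
  refine ⟨fun i => (v i).2, ?_⟩
  ext ⟨i, x⟩
  rw [auxEnc_mem]
  constructor
  · intro h
    simp only at h
    have h2 := (hm i).2
    have : v i = (i, x) := Prod.ext h2 h
    rw [← this]
    exact (hm i).1
  · intro h
    have : (i, x) ∈ e.filter (fun x => x.1 = i) := by simp [h]
    rw [hv i, mem_singleton] at this
    simp [← this]

/-- Functions are the same as transversal edges. -/
noncomputable def auxPhi (r n : ℕ) : (Fin r → Fin n) ≃ {e // e ∈ transversals r n} :=
  Equiv.ofBijective (fun g => ⟨auxEnc g, auxEnc_trans g⟩)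
    ⟨fun _ _ hgh => auxEnc_inj (Subtype.ext_iff.1 hgh),
      fun e => (auxEnc_surj e.1 e.2).imp fun _ h => Subtype.ext h⟩

lemma aux_prefix {r n : ℕ}
    (ω : Fin (transversals r n).card ≃ {e : Finset (Fin r × Fin n) // e ∈ transversals r n})
    (k : ℕ) (g : Fin r → Fin n) :
    auxEnc g ∈ hPrefix ω k ↔ ((ω.trans (auxPhi r n).symm).symm g : ℕ) < k := by
  simp only [hPrefix, mem_image, mem_filter, mem_univ, true_and, Equiv.symm_trans_apply,
    Equiv.symm_symm]
  have h0 : (auxPhi r n g).1 = auxEnc g := rfl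
  constructor
  · rintro ⟨j, hj, h⟩
    have : ω j = auxPhi r n g := Subtype.ext (h.trans h0.symm)
    rw [← this]
    simpa using hj
  · intro h
    exact ⟨_, h, by simp [h0]⟩

lemma aux_prefix_sub {r n : ℕ}
    (ω : Fin (transversals r n).card ≃ {e : Finset (Fin r × Fin n) // e ∈ transversals r n})
    (k : ℕ) (e : Finset (Fin r × Fin n)) (he : e ∈ hPrefix ω k) : ∃ g, auxEnc g = e := by
  simp only [hPrefix, mem_image] at he
  obtain ⟨j, -, rfl⟩ := he
  exact auxEnc_surj _ (ω j).2

lemma aux_cov {r n : ℕ}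
    (ω : Fin (transversals r n).card ≃ {e : Finset (Fin r × Fin n) // e ∈ transversals r n})
    (k : ℕ) : (∀ v, ∃ e ∈ hPrefix ω k, v ∈ e) ↔
      ∀ i x, ∃ g : Fin r → Fin n, ((ω.trans (auxPhi r n).symm).symm g : ℕ) < k ∧ g i = x := by
  constructor
  · intro h i x
    obtain ⟨e, he, hv⟩ := h (i, x)
    obtain ⟨g, rfl⟩ := aux_prefix_sub ω k e he
    exact ⟨g, (aux_prefix ω k g).1 he, (auxEnc_mem g _).1 hv⟩
  · rintro h ⟨i, x⟩
    obtain ⟨g, hg, hx⟩ := h i x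
    exact ⟨auxEnc g, (aux_prefix ω k g).2 hg, (auxEnc_mem g _).2 hx⟩

lemma aux_good {r n : ℕ} (hr : 0 < r) (hn : 1 ≤ n)
    (ω : Fin (transversals r n).card ≃ {e : Finset (Fin r × Fin n) // e ∈ transversals r n})
    (M : Finset (Fin r → Fin n)) (hM : auxIsM M) :
    M.image auxEnc ⊆ hFinal ω ↔ ∃ e ∈ M,
      (∀ a ∈ M.erase e, (ω.trans (auxPhi r n).symm).symm a < (ω.trans (auxPhi r n).symm).symm e) ∧
      ∃ i : Fin r, ∀ f, f ≠ e → f i = e i →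
        (ω.trans (auxPhi r n).symm).symm e < (ω.trans (auxPhi r n).symm).symm f := by
  have h1 : M.image auxEnc ⊆ hFinal ω ↔
      ∀ g ∈ M, ((ω.trans (auxPhi r n).symm).symm g : ℕ) < hStop ω := by
    rw [image_subset_iff]
    simp only [hFinal, aux_prefix]
  have h2 : hStop ω = sInf {k | ∀ i x, ∃ g : Fin r → Fin n,
      ((ω.trans (auxPhi r n).symm).symm g : ℕ) < k ∧ g i = x} := by
    simp only [hStop, aux_cov]
  rw [h1, h2]
  generalize ω.trans (auxPhi r n).symm = τ
  set K := {k | ∀ i x, ∃ g : Fin r → Fin n, (τ.symm g : ℕ) < k ∧ g i = x} with hK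
  have hne : K.Nonempty := by
    refine ⟨(transversals r n).card, fun i x => ⟨fun _ => x, ?_, rfl⟩⟩
    exact (τ.symm _).2
  constructor
  · intro h
    have hMne : M.Nonempty := by
      obtain ⟨g, hg, -⟩ := hM ⟨0, hr⟩ ⟨0, hn⟩
      exact ⟨g, hg.1⟩
    obtain ⟨e, he, hmax⟩ := exists_max_image M (fun g => τ.symm g) hMne
    refine ⟨e, he, ?_, ?_⟩
    · intro a ha
      rw [mem_erase] at ha
      exact lt_of_le_of_ne (hmax a ha.2) (fun h => ha.1 (τ.symm.injective h))
    · have hn := Nat.notMem_of_lt_sInf (h e he)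
      simp only [hK, Set.mem_ofPred_eq] at hn
      push Not at hn
      obtain ⟨i, x, hx⟩ := hn
      obtain ⟨g, ⟨hg, hgx⟩, -⟩ := hM i x
      have hge : g = e := by
        by_contra hne
        refine hx g ?_ hgx
        exact lt_of_le_of_ne (hmax g hg) (fun h => hne (τ.symm.injective (Fin.ext h)))
      subst hge
      refine ⟨i, fun f hf hfi => ?_⟩
      refine lt_of_le_of_ne ?_ (fun h => hf (τ.symm.injective h).symm)
      by_contra hlt
      exact hx f (by simpa using hlt) (hfi.trans hgx)
  · rintro ⟨e, he, hlast, i, hi⟩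
    have hek : (τ.symm e : ℕ) < sInf K := by
      by_contra hcon
      push Not at hcon
      obtain ⟨g, hg, hgi⟩ := (Nat.sInf_mem hne) i (e i)
      have hlt : τ.symm g < τ.symm e := Fin.lt_def.2 (lt_of_lt_of_le hg hcon)
      have hge : g ≠ e := by rintro rfl; exact lt_irrefl _ hlt
      exact lt_asymm hlt (hi g hge hgi)
    intro g hg
    by_cases hge : g = e
    · rw [hge]; exact hek
    · exact lt_trans (hlast g (mem_erase.2 ⟨hge, hg⟩)) hek

lemma aux_isM {r n : ℕ} (M : Finset (Fin r → Fin n)) :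
    hIsMatching (M.image auxEnc) ↔ auxIsM M := by
  constructor
  · intro h i x
    obtain ⟨e, ⟨he, hv⟩, hu⟩ := h (i, x)
    obtain ⟨g, hg, rfl⟩ := mem_image.1 he
    refine ⟨g, ⟨hg, (auxEnc_mem g _).1 hv⟩, ?_⟩
    rintro f ⟨hf, hfx⟩
    exact auxEnc_inj (hu _ ⟨mem_image_of_mem _ hf, (auxEnc_mem f _).2 hfx⟩)
  · rintro h ⟨i, x⟩
    obtain ⟨g, ⟨hg, hx⟩, hu⟩ := h i x
    refine ⟨auxEnc g, ⟨mem_image_of_mem _ hg, (auxEnc_mem g _).2 hx⟩, ?_⟩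
    rintro e ⟨he, hv⟩
    obtain ⟨f, hf, rfl⟩ := mem_image.1 he
    rw [hu f ⟨hf, (auxEnc_mem f _).1 hv⟩]

open Classical in
lemma aux_ncard {r n : ℕ} (hr : 0 < r) (hn : 1 ≤ n)
    (ω : Fin (transversals r n).card ≃ {e : Finset (Fin r × Fin n) // e ∈ transversals r n}) :
    {M : Finset (Finset (Fin r × Fin n)) | M ⊆ hFinal ω ∧ hIsMatching M}.ncard =
    ((univ.filter (fun M : Finset (Fin r → Fin n) => auxIsM M)).filter (fun M => ∃ e ∈ M,
      (∀ a ∈ M.erase e, (ω.trans (auxPhi r n).symm).symm a < (ω.trans (auxPhi r n).symm).symm e) ∧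
      ∃ i : Fin r, ∀ f, f ≠ e → f i = e i →
        (ω.trans (auxPhi r n).symm).symm e < (ω.trans (auxPhi r n).symm).symm f)).card := by
  rw [← Set.ncard_coe_finset,
    ← Set.ncard_image_of_injective _ (Finset.image_injective (auxEnc_inj (r := r) (n := n)))]
  congr 1
  ext M
  simp only [Set.mem_ofPred_eq, Set.mem_image, coe_filter, mem_filter, mem_univ, true_and]
  constructor
  · rintro ⟨h1, h2⟩
    have : ∃ M' : Finset (Fin r → Fin n), M'.image auxEnc = M := by
      refine ⟨univ.filter (fun g => auxEnc g ∈ M), ?_⟩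
      ext e
      simp only [mem_image, mem_filter, mem_univ, true_and]
      constructor
      · rintro ⟨g, hg, rfl⟩; exact hg
      · intro he
        obtain ⟨g, rfl⟩ := aux_prefix_sub ω _ e (h1 he)
        exact ⟨g, he, rfl⟩
    obtain ⟨M', rfl⟩ := this
    have hM := (aux_isM M').1 h2
    exact ⟨M', ⟨hM, (aux_good hr hn ω M' hM).1 h1⟩, rfl⟩
  · rintro ⟨M', ⟨hM, h⟩, rfl⟩
    exact ⟨(aux_good hr hn ω M' hM).2 h, (aux_isM M').2 hM⟩

lemma aux_reindex {r n : ℕ} (G : (Fin (transversals r n).card ≃ (Fin r → Fin n)) → ℝ) :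
    ∑ ω : Fin (transversals r n).card ≃ {e : Finset (Fin r × Fin n) // e ∈ transversals r n},
      G (ω.trans (auxPhi r n).symm) = ∑ τ, G τ :=
  Fintype.sum_equiv
    (Equiv.equivCongr (Equiv.refl (Fin (transversals r n).card)) (auxPhi r n).symm) _ _
    (fun _ => rfl)

/-- Take the `n^r` transversal edges of `K_{n,…,n}` in a uniformly random order, stopping
as soon as every vertex is covered; this gives a random `r`-uniform hypergraph `G_ω`.
The expected number of matchings contained in `G_ω` equals
`(n!)^{r−1} · Σ_{i=1}^{r} (−1)^{i−1} C(r,i) / C(n^r − (n−1)^i n^{r−i} + n − 1, n)`. -/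
theorem expected_number_of_matchings_multipartite_hypergraph (r n : ℕ) (hr : 2 ≤ r)
    (hn : 1 ≤ n) :
    (∑ ω : Fin (transversals r n).card ≃ {e : Finset (Fin r × Fin n) // e ∈ transversals r n},
        ({M : Finset (Finset (Fin r × Fin n)) | M ⊆ hFinal ω ∧ hIsMatching M}.ncard : ℝ)) /
      (Fintype.card (Fin (transversals r n).card ≃
        {e : Finset (Fin r × Fin n) // e ∈ transversals r n}) : ℝ) =
    (n.factorial : ℝ) ^ (r - 1) *
      ∑ i ∈ Finset.Icc 1 r, (-1 : ℝ) ^ (i - 1) * (r.choose i : ℝ) /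
        ((n ^ r - (n - 1) ^ i * n ^ (r - i) + n - 1).choose n : ℝ) := by
  classical
  have hr0 : 0 < r := by omega
  have e0 : (Fin (transversals r n).card ≃ {e : Finset (Fin r × Fin n) // e ∈ transversals r n})
    ≃ (Fin (transversals r n).card ≃ (Fin r → Fin n)) :=
    Equiv.equivCongr (Equiv.refl _) (auxPhi r n).symm
  simp only [aux_ncard hr0 hn]
  have hs := aux_reindex
    (fun τ : Fin (transversals r n).card ≃ (Fin r → Fin n) =>
      (((univ.filter (fun M : Finset (Fin r → Fin n) => auxIsM M)).filter (fun M => ∃ e ∈ M,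
      (∀ a ∈ M.erase e, τ.symm a < τ.symm e) ∧
      ∃ i : Fin r, ∀ f, f ≠ e → f i = e i → τ.symm e < τ.symm f)).card : ℝ))
  beta_reduce at hs
  rw [Fintype.card_congr e0, hs, ← Nat.cast_sum]
  have hsw := sum_card_bipartiteAbove_eq_sum_card_bipartiteBelow
    (s := (univ : Finset (Fin (transversals r n).card ≃ (Fin r → Fin n))))
    (t := univ.filter (fun M : Finset (Fin r → Fin n) => auxIsM M))
    (fun τ M => ∃ e ∈ M, (∀ a ∈ M.erase e, τ.symm a < τ.symm e) ∧
      ∃ i : Fin r, ∀ f, f ≠ e → f i = e i → τ.symm e < τ.symm f)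
  simp only [bipartiteAbove, bipartiteBelow] at hsw
  rw [hsw, Nat.cast_sum, sum_congr rfl
    (fun M hM => auxM_total hr0 hn M (mem_filter.1 hM).2), sum_const, nsmul_eq_mul]
  have hcard : (univ.filter (fun M : Finset (Fin r → Fin n) => auxIsM M)).card
      = n.factorial ^ (r - 1) := by
    obtain ⟨k, rfl⟩ : ∃ k, r = k + 1 := ⟨r - 1, by omega⟩
    exact auxM_count
  rw [hcard, Nat.cast_pow, mul_left_comm, mul_div_cancel_left₀]
  have : Nonempty (Fin (transversals r n).card ≃ (Fin r → Fin n)) :=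
    ⟨e0 (Fintype.equivOfCardEq (by simp))⟩
  exact_mod_cast Fintype.card_ne_zero
end

section
/- With V a set of rn vertices, E the set of all r-element subsets of V, and G_ω the random r-uniform hypergraph obtained by taking a uniformly random ordering of E and stopping as soon as every vertex is covered, the expected number of matchings contained in G_ω equals ((rn)! / ((r!)^n · n!)) · Σ_{i=1}^{r} (−1)^{i−1} · binom(r, i) / binom( binom(nr, r) − binom(nr−i, r) + n − 1, n ). -/
open Finset

def PM {V : Type*} [DecidableEq V] (r : ℕ) (S : Finset V) : Finset (Finset (Finset V)) :=
  (powersetCard r S).powerset.filter (fun M => ∀ v ∈ S, #{e ∈ M | v ∈ e} = 1)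

lemma PM_card_mem {V : Type*} [DecidableEq V] {r : ℕ} {S : Finset V} {M : Finset (Finset V)}
    (hM : M ∈ PM r S) : r * #M = #S := by
  simp only [PM, mem_filter, mem_powerset] at hM
  obtain ⟨h1, h2⟩ := hM
  have h := Finset.sum_card_bipartiteAbove_eq_sum_card_bipartiteBelow
    (s := S) (t := M) (fun v e => v ∈ e)
  have h2' : ∀ v ∈ S, #(bipartiteAbove (fun v e => v ∈ e) M v) = 1 := h2
  rw [Finset.sum_congr rfl h2'] at h
  rw [Finset.sum_congr (s₁ := M) rfl (g := fun _ => r)] at h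
  · simp at h; rw [h, mul_comm]
  · intro e he
    have := h1 he
    rw [mem_powersetCard] at this
    rw [← this.2]
    congr 1
    ext v
    simp only [bipartiteBelow, mem_filter]
    exact ⟨fun h => h.2, fun h => ⟨this.1 h, h⟩⟩

lemma PM_erase {V : Type*} [DecidableEq V] {r : ℕ} (hr : 0 < r) {S e : Finset V}
    (he : e ∈ powersetCard r S) : #{M ∈ PM r S | e ∈ M} = #(PM r (S \ e)) := by
  rw [mem_powersetCard] at he
  have key : ∀ M : Finset (Finset V), e ∉ M → ∀ v, #{x ∈ insert e M | v ∈ x} = #{x ∈ M | v ∈ x} + if v ∈ e then 1 else 0 := by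
    intro M h v
    rw [filter_insert]
    split_ifs with hv
    · rw [card_insert_of_notMem]; simp [h]
    · simp
  have hne : e.Nonempty := by rw [← card_pos]; omega
  have hnot : ∀ M ∈ PM r (S \ e), e ∉ M := by
    intro M hM h
    simp only [PM, mem_filter, mem_powerset] at hM
    have := hM.1 h
    rw [mem_powersetCard] at this
    obtain ⟨x, hx⟩ := hne
    have := this.1 hx
    simp [hx] at this
  refine Finset.card_nbij' (fun M => M.erase e) (fun M => insert e M) ?_ ?_ ?_ ?_
  · intro M hM
    simp only [coe_filter, Set.mem_ofPred_eq, PM, mem_filter, mem_powerset] at hM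
    obtain ⟨⟨h1, h2⟩, h3⟩ := hM
    have k := key (M.erase e) (by simp)
    rw [insert_erase h3] at k
    simp only [PM, coe_filter, Set.mem_ofPred_eq, mem_powerset, mem_sdiff]
    refine ⟨?_, ?_⟩
    · intro x hx
      have hx' := mem_powersetCard.1 (h1 (mem_of_mem_erase hx))
      rw [mem_powersetCard]
      refine ⟨?_, hx'.2⟩
      intro v hv
      rw [mem_sdiff]
      refine ⟨hx'.1 hv, fun hve => ?_⟩
      have := k v
      rw [h2 v (hx'.1 hv), if_pos hve] at this
      have h0 : #{x ∈ M.erase e | v ∈ x} = 0 := by omega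
      rw [card_eq_zero, filter_eq_empty_iff] at h0
      exact h0 hx hv
    · rintro v ⟨hv, hve⟩
      have := k v
      rw [h2 v hv, if_neg hve] at this
      omega
  · intro M hM
    have hn := hnot M hM
    simp only [PM, coe_filter, Set.mem_ofPred_eq, mem_powerset, mem_sdiff] at hM
    obtain ⟨h1, h2⟩ := hM
    simp only [coe_filter, Set.mem_ofPred_eq, PM, mem_filter, mem_powerset]
    refine ⟨⟨?_, ?_⟩, by simp⟩
    · rw [insert_subset_iff]
      exact ⟨mem_powersetCard.2 he, h1.trans (powersetCard_mono sdiff_subset)⟩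
    · intro v hv
      rw [key M hn]
      by_cases hve : v ∈ e
      · rw [if_pos hve, card_eq_zero.2]
        rw [filter_eq_empty_iff]
        intro x hx hvx
        have := (mem_powersetCard.1 (h1 hx)).1 hvx
        simp [hve] at this
      · rw [if_neg hve, h2 v ⟨hv, hve⟩]
  · intro M hM
    simp only [coe_filter, Set.mem_ofPred_eq] at hM
    exact insert_erase hM.2
  · intro M hM
    exact erase_insert (hnot M hM)

lemma PM_count {V : Type*} [DecidableEq V] {r : ℕ} (hr : 0 < r) (n : ℕ) : ∀ S : Finset V,
    #S = r * n → #(PM r S) * (r.factorial ^ n * n.factorial) = (r * n).factorial := by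
  induction n with
  | zero =>
    intro S hS
    simp at hS
    subst hS
    have : powersetCard r (∅ : Finset V) = ∅ := by
      rw [powersetCard_eq_empty]; simpa
    simp [PM, this]
  | succ n ih =>
    intro S hS
    have h := Finset.sum_card_bipartiteAbove_eq_sum_card_bipartiteBelow
      (s := PM r S) (t := powersetCard r S) (fun M e => e ∈ M)
    have h1 : ∀ M ∈ PM r S, #(bipartiteAbove (fun M e => e ∈ M) (powersetCard r S) M) = n + 1 := by
      intro M hM
      have := PM_card_mem hM
      rw [hS] at this
      rw [← Nat.eq_of_mul_eq_mul_left hr this]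
      congr 1
      ext e
      simp only [PM, mem_filter, mem_powerset] at hM
      simp only [bipartiteAbove, mem_filter]
      exact ⟨fun h => h.2, fun h => ⟨hM.1 h, h⟩⟩
    have h2 : ∀ e ∈ powersetCard r S, #(bipartiteBelow (fun M e => e ∈ M) (PM r S) e) * (r.factorial ^ n * n.factorial) = (r * n).factorial := by
      intro e he
      rw [bipartiteBelow, PM_erase hr he]
      apply ih
      rw [mem_powersetCard] at he
      rw [card_sdiff_of_subset he.1, hS, he.2, mul_add, mul_one, Nat.add_sub_cancel]
    rw [sum_congr rfl h1, sum_const, smul_eq_mul] at h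
    have h3 : #(PM r S) * (n+1) * (r.factorial ^ n * n.factorial) = (r * (n+1)).choose r * (r * n).factorial := by
      rw [h, sum_mul, sum_congr rfl h2, sum_const, card_powersetCard, hS, smul_eq_mul]
    have h4 := Nat.choose_mul_factorial_mul_factorial (n := r * (n+1)) (k := r) (by nlinarith)
    have h5 : r * (n+1) - r = r * n := by rw [mul_add, mul_one, Nat.add_sub_cancel]
    rw [h5] at h4
    rw [← h4, Nat.factorial_succ, pow_succ]
    calc _ = #(PM r S) * (n+1) * (r.factorial ^ n * n.factorial) * r.factorial := by ring
      _ = _ := by rw [h3]; ring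

def OC {α : Type*} [Fintype α] [DecidableEq α] {N : ℕ} (A : Finset α) (e : α) (B : Finset α) :
    Finset (Fin N ≃ α) :=
  univ.filter (fun ω => (∀ a ∈ A, ω.symm a < ω.symm e) ∧ (∀ b ∈ B, ω.symm e < ω.symm b))

lemma OC_base {α : Type*} [Fintype α] [DecidableEq α] {N : ℕ} (hN : Fintype.card α = N)
    (A : Finset α) (e : α) (B : Finset α) (heA : e ∉ A) (heB : e ∉ B) (hAB : Disjoint A B)
    (hU : ∀ x, x ∈ A ∨ x = e ∨ x ∈ B) :
    #(OC (N := N) A e B) = (#A).factorial * (#B).factorial := by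
  have hABx : ∀ x, x ∈ A → x ∉ B := fun x h1 h2 => (Finset.disjoint_left.1 hAB h1 h2)
  let f : α → Fin 3 := fun x => if x ∈ A then 0 else if x = e then 1 else 2
  let g : Fin N → Fin 3 := fun j => if (j : ℕ) < #A then 0 else if (j : ℕ) = #A then 1 else 2
  have f0 : ∀ x, f x = 0 ↔ x ∈ A := by intro x; simp only [f]; split_ifs <;> simp_all
  have f1 : ∀ x, f x = 1 ↔ x = e := by
    intro x; simp only [f]; split_ifs <;> simp_all
    rintro rfl; contradiction
  have f2 : ∀ x, f x = 2 ↔ x ∈ B := by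
    intro x; have := hU x; have := hABx x
    simp only [f]; split_ifs <;> simp_all
  have g0 : ∀ x, g x = 0 ↔ (x : ℕ) < #A := by intro x; simp only [g]; split_ifs <;> simp_all
  have g1 : ∀ x, g x = 1 ↔ (x : ℕ) = #A := by
    intro x; simp only [g]; split_ifs <;> simp_all
    omega
  have g2 : ∀ x, g x = 2 ↔ #A < (x : ℕ) := by
    intro x; simp only [g]; split_ifs <;> simp_all <;> omega
  have hcardU : #A + 1 + #B = N := by
    have : (univ : Finset α) = insert e (A ∪ B) := by
      ext x; have := hU x; simp; tauto
    rw [← hN, ← card_univ, this, card_insert_of_notMem (by simp [heA, heB]), card_union_of_disjoint hAB]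
    omega
  have cf0 : Fintype.card {x // f x = 0} = #A := by
    rw [Fintype.card_subtype]; congr 1; ext x; simp [f0]
  have cf1 : Fintype.card {x // f x = 1} = 1 := by
    rw [Fintype.card_subtype, card_eq_one]; use e; ext x; simp [f1]
  have cf2 : Fintype.card {x // f x = 2} = #B := by
    rw [Fintype.card_subtype]; congr 1; ext x; simp [f2]
  have hlt : #A < N := by omega
  have cg0 : Fintype.card {x // g x = 0} = #A := by
    rw [Fintype.card_subtype]
    have : (univ.filter (fun x => g x = 0)) = Finset.Iio (⟨#A, hlt⟩ : Fin N) := by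
      ext x; simp [g0, Fin.lt_def]
    rw [this, Fin.card_Iio]
  have cg1 : Fintype.card {x // g x = 1} = 1 := by
    rw [Fintype.card_subtype, card_eq_one]; use ⟨#A, hlt⟩; ext x; simp [g1, Fin.ext_iff]
  have cg2 : Fintype.card {x // g x = 2} = #B := by
    rw [Fintype.card_subtype]
    have : (univ.filter (fun x => g x = 2)) = Finset.Ioi (⟨#A, hlt⟩ : Fin N) := by
      ext x; simp [g2, Fin.lt_def]
    rw [this, Fin.card_Ioi]; simp; omega
  have hfib : ∀ c : Fin 3, Nonempty ({x // g x = c} ≃ {x // f x = c}) := by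
    intro c
    apply Nonempty.intro
    apply Fintype.equivOfCardEq
    fin_cases c
    · exact cg0.trans cf0.symm
    · exact cg1.trans cf1.symm
    · exact cg2.trans cf2.symm
  let ω0 : Fin N ≃ α := Equiv.ofFiberEquiv (fun c => (hfib c).some)
  have hω0 : ∀ j, f (ω0 j) = g j := fun j => Equiv.ofFiberEquiv_map _ j
  have hst := DomMulAct.stabilizer_card f
  rw [Fin.prod_univ_three, cf0, cf1, cf2] at hst
  simp only [Nat.factorial_one, mul_one] at hst
  rw [← hst, Fintype.card_subtype]
  have hchar : ∀ ω : Fin N ≃ α, ω ∈ OC A e B ↔ ∀ j, f (ω j) = g j := by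
    intro ω
    simp only [OC, mem_filter, mem_univ, true_and]
    constructor
    · rintro ⟨h1, h2⟩
      have hx : Finset.Iio (ω.symm e) = A.map ω.symm.toEmbedding := by
        ext j
        simp only [mem_Iio, mem_map_equiv, Equiv.symm_symm]
        constructor
        · intro hj
          rcases hU (ω j) with h | h | h
          · exact h
          · rw [← h] at hj; simp at hj
          · have := h2 _ h; simp at this; exact absurd hj (not_lt.2 this.le)
        · intro h
          have := h1 _ h; simpa using this
      have hpe : ((ω.symm e : Fin N) : ℕ) = #A := by
        rw [← card_map ω.symm.toEmbedding, ← hx, Fin.card_Iio]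
      intro j
      rcases hU (ω j) with h | h | h
      · rw [(f0 _).2 h]; symm; rw [g0]
        have := h1 _ h
        simp only [Equiv.symm_apply_apply, Fin.lt_def] at this; omega
      · rw [(f1 _).2 h]; symm; rw [g1, ← hpe, ← h]; simp
      · rw [(f2 _).2 h]; symm; rw [g2]
        have := h2 _ h
        simp only [Equiv.symm_apply_apply, Fin.lt_def] at this; omega
    · intro h
      have h' : ∀ x, g (ω.symm x) = f x := by intro x; rw [← h]; simp
      have he := (g1 _).1 ((h' e).trans ((f1 e).2 rfl))
      refine ⟨fun a ha => ?_, fun b hb => ?_⟩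
      · have := (g0 _).1 ((h' a).trans ((f0 a).2 ha))
        rw [Fin.lt_def]; omega
      · have := (g2 _).1 ((h' b).trans ((f2 b).2 hb))
        rw [Fin.lt_def]; omega
  refine Finset.card_nbij' (fun ω => ω0.symm.trans ω) (fun p => ω0.trans p) ?_ ?_ ?_ ?_
  · intro ω hω
    have h := (hchar ω).1 hω
    simp only [coe_filter, mem_univ, true_and, Set.mem_ofPred_eq]
    ext1 x
    simp only [Function.comp, Equiv.trans_apply]
    rw [h, ← hω0]; simp
  · intro p hp
    simp only [coe_filter, mem_univ, true_and, Set.mem_ofPred_eq] at hp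
    rw [mem_coe, hchar]
    intro j
    rw [← hω0]
    exact congrFun hp (ω0 j)
  · intro ω _; ext; simp
  · intro ω _; ext; simp

lemma OC_count {α : Type*} [Fintype α] [DecidableEq α] {N : ℕ} (hN : Fintype.card α = N) (e : α)
    (k : ℕ) : ∀ (A B : Finset α), e ∉ A → e ∉ B → Disjoint A B → #A + #B + 1 + k = N →
    #(OC (N := N) A e B) * (#A + #B + 1).factorial =
      (#A).factorial * (#B).factorial * N.factorial := by
  induction k with
  | zero =>
    intro A B heA heB hAB hk
    rw [OC_base hN A e B heA heB hAB, ← hk]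
    have h1 : insert e (A ∪ B) = univ := by
      rw [← card_eq_iff_eq_univ, card_insert_of_notMem (by simp [heA, heB]), card_union_of_disjoint hAB]
      omega
    intro x
    have := mem_univ x
    rw [← h1] at this
    simp at this; tauto
  | succ k ih =>
    intro A B heA heB hAB hk
    have h1 : ∃ x, x ∉ insert e (A ∪ B) := by
      by_contra! h
      have := card_eq_iff_eq_univ (insert e (A ∪ B)) |>.2 (by ext x; simpa using h x)
      rw [card_insert_of_notMem (by simp [heA, heB]), card_union_of_disjoint hAB] at this
      omega
    obtain ⟨x, hx⟩ := h1
    simp only [mem_insert, mem_union, not_or] at hx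
    obtain ⟨hxe, hxA, hxB⟩ := hx
    have hsplit : (OC (N := N) A e B) = OC (insert x A) e B ∪ OC A e (insert x B) := by
      ext ω
      have : ω.symm x < ω.symm e ∨ ω.symm e < ω.symm x := by
        apply lt_or_gt_of_ne; simpa using hxe
      simp only [OC, mem_filter, mem_univ, true_and, mem_union, mem_insert, forall_eq_or_imp]
      tauto
    have hdis : Disjoint (OC (N := N) (insert x A) e B) (OC A e (insert x B)) := by
      rw [disjoint_left]
      intro ω h1 h2
      simp only [OC, mem_filter, mem_univ, true_and, mem_insert, forall_eq_or_imp] at h1 h2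
      exact lt_asymm h1.1.1 h2.2.1
    have i1 := ih (insert x A) B (by simp [heA, Ne.symm hxe]) heB (by simp [hAB, hxB])
      (by rw [card_insert_of_notMem hxA]; omega)
    have i2 := ih A (insert x B) heA (by simp [heB, Ne.symm hxe]) (by simp [hAB, hxA])
      (by rw [card_insert_of_notMem hxB]; omega)
    rw [card_insert_of_notMem hxA] at i1
    rw [card_insert_of_notMem hxB] at i2
    rw [hsplit, card_union_of_disjoint hdis]
    have e1 : #A + 1 + #B + 1 = (#A + #B + 1) + 1 := by ring
    have e2 : #A + (#B + 1) + 1 = (#A + #B + 1) + 1 := by ring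
    rw [e1, Nat.factorial_succ, Nat.factorial_succ (#A)] at i1
    rw [e2, Nat.factorial_succ, Nat.factorial_succ (#B)] at i2
    apply Nat.eq_of_mul_eq_mul_left (Nat.succ_pos (#A + #B + 1))
    simp only [Nat.succ_eq_add_one]
    linear_combination i1 + i2

def setA {V : Type*} [DecidableEq V] {s : Finset (Finset V)} (M : Finset (Finset V))
    (e : {e : Finset V // e ∈ s}) : Finset {e : Finset V // e ∈ s} :=
  univ.filter (fun g => g.1 ∈ M ∧ g ≠ e)

def setB {V : Type*} [DecidableEq V] {s : Finset (Finset V)} (t : Finset V)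
    (e : {e : Finset V // e ∈ s}) : Finset {e : Finset V // e ∈ s} :=
  univ.filter (fun g => ¬ Disjoint g.1 t ∧ g ≠ e)

lemma mem_hPrefix {V : Type*} [DecidableEq V] {s : Finset (Finset V)}
    (ω : Fin s.card ≃ {e : Finset V // e ∈ s}) (i : ℕ) (g : Finset V) :
    g ∈ hPrefix ω i ↔ ∃ h : g ∈ s, ((ω.symm ⟨g, h⟩ : Fin s.card) : ℕ) < i := by
  simp only [hPrefix, mem_image, mem_filter, mem_univ, true_and]
  constructor
  · rintro ⟨j, hj, rfl⟩
    exact ⟨(ω j).2, by simpa using hj⟩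
  · rintro ⟨h, hi⟩
    exact ⟨_, hi, by simp⟩

lemma final_char {V : Type*} [Fintype V] [DecidableEq V] [Nonempty V] {s : Finset (Finset V)}
    (ω : Fin s.card ≃ {e : Finset V // e ∈ s}) (M : Finset (Finset V)) (hMs : M ⊆ s)
    (hM : ∀ v : V, ∃ e ∈ M, v ∈ e) :
    M ⊆ hFinal ω ↔ ∃ e : {e : Finset V // e ∈ s}, e.1 ∈ M ∧ ∃ v ∈ e.1,
      ω ∈ OC (setA M e) e (setB {v} e) := by
  have hmem : hStop ω ∈ {i | ∀ v : V, ∃ e ∈ hPrefix ω i, v ∈ e} := by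
    apply Nat.sInf_mem
    refine ⟨s.card, fun v => ?_⟩
    obtain ⟨e, he, hv⟩ := hM v
    exact ⟨e, (mem_hPrefix _ _ _).2 ⟨hMs he, Fin.is_lt _⟩, hv⟩
  have hmem' : ∀ v : V, ∃ e ∈ hPrefix ω (hStop ω), v ∈ e := hmem
  simp only [OC, mem_filter, mem_univ, true_and, setA, setB, disjoint_singleton_right, not_not]
  constructor
  · intro h
    have hne : (univ.filter (fun g : {e : Finset V // e ∈ s} => g.1 ∈ M)).Nonempty := by
      obtain ⟨e, he, _⟩ := hM (Classical.arbitrary V)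
      exact ⟨⟨e, hMs he⟩, by simpa using he⟩
    obtain ⟨e, he, hmax⟩ := exists_max_image _ (fun g => ω.symm g) hne
    simp only [mem_filter, mem_univ, true_and] at he hmax
    obtain ⟨_, hlt⟩ := (mem_hPrefix _ _ _).1 (h he)
    have hnot := Nat.notMem_of_lt_sInf (hlt : _ < sInf _)
    have hnot' : ¬ ∀ v : V, ∃ g ∈ hPrefix ω (ω.symm e : Fin s.card), v ∈ g := hnot
    push Not at hnot'
    obtain ⟨v, hv⟩ := hnot'
    have hv' : ∀ g : {e : Finset V // e ∈ s}, v ∈ g.1 → ω.symm e ≤ ω.symm g := by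
      intro g hg
      by_contra! hc
      exact hv g.1 ((mem_hPrefix _ _ _).2 ⟨g.2, hc⟩) hg
    have hve : v ∈ e.1 := by
      obtain ⟨m, hm, hvm⟩ := hM v
      have h1 := hv' ⟨m, hMs hm⟩ hvm
      have h2 := hmax ⟨m, hMs hm⟩ hm
      have := ω.symm.injective (le_antisymm h1 h2)
      rw [this]; exact hvm
    refine ⟨e, he, v, hve, ?_, ?_⟩
    · rintro a ⟨ha, hae⟩
      exact lt_of_le_of_ne (hmax a ha) (by simpa using hae)
    · rintro b ⟨hb, hbe⟩
      exact lt_of_le_of_ne (hv' b hb) (by simpa using Ne.symm hbe)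
  · rintro ⟨e, he, v, hve, h1, h2⟩ m hm
    obtain ⟨g, hg, hvg⟩ := hmem' v
    obtain ⟨hgs, hgl⟩ := (mem_hPrefix _ _ _).1 hg
    refine (mem_hPrefix _ _ _).2 ⟨hMs hm, ?_⟩
    have a1 : ω.symm ⟨m, hMs hm⟩ ≤ ω.symm e := by
      by_cases h : (⟨m, hMs hm⟩ : {e : Finset V // e ∈ s}) = e
      · rw [h]
      · exact (h1 _ ⟨hm, h⟩).le
    have a2 : ω.symm e ≤ ω.symm ⟨g, hgs⟩ := by
      by_cases h : (⟨g, hgs⟩ : {e : Finset V // e ∈ s}) = e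
      · rw [h]
      · exact (h2 _ ⟨hvg, h⟩).le
    exact lt_of_le_of_lt (a1.trans a2) hgl

lemma setA_card {V : Type*} [DecidableEq V] {s : Finset (Finset V)} (M : Finset (Finset V))
    (hMs : M ⊆ s) (e : {e : Finset V // e ∈ s}) (he : e.1 ∈ M) : #(setA M e) = #M - 1 := by
  rw [← card_erase_of_mem he, ← card_map (Function.Embedding.subtype _)]
  congr 1
  ext g
  simp only [setA, mem_map, mem_filter, mem_univ, true_and, Function.Embedding.subtype_apply,
    mem_erase]
  constructor
  · rintro ⟨g, ⟨h1, h2⟩, rfl⟩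
    exact ⟨fun h => h2 (Subtype.ext h), h1⟩
  · rintro ⟨h1, h2⟩
    exact ⟨⟨g, hMs h2⟩, ⟨h2, fun h => h1 (congrArg Subtype.val h)⟩, rfl⟩

lemma setB_card {V : Type*} [Fintype V] [DecidableEq V] (r : ℕ) (t : Finset V)
    (e : {e : Finset V // e ∈ (powersetCard r univ : Finset (Finset V))})
    (hte : t ⊆ e.1) (ht : t.Nonempty) :
    #(setB t e) = (Fintype.card V).choose r - (Fintype.card V - #t).choose r - 1 := by
  have hm : e.1 ∈ (powersetCard r univ : Finset (Finset V)) \ powersetCard r tᶜ := by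
    rw [mem_sdiff]
    refine ⟨e.2, fun h => ?_⟩
    obtain ⟨x, hx⟩ := ht
    have := (mem_powersetCard.1 h).1 (hte hx)
    simp [hx] at this
  have h1 : #((powersetCard r univ : Finset (Finset V)) \ powersetCard r tᶜ) =
      (Fintype.card V).choose r - (Fintype.card V - #t).choose r := by
    rw [card_sdiff_of_subset (powersetCard_mono (subset_univ _)), card_powersetCard,
      card_powersetCard, card_compl, card_univ]
  rw [← h1, ← card_erase_of_mem hm, ← card_map (Function.Embedding.subtype _)]
  congr 1
  ext g
  simp only [setB, mem_map, mem_filter, mem_univ, true_and, Function.Embedding.subtype_apply,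
    mem_erase, mem_sdiff, mem_powersetCard, ← disjoint_left, subset_compl_iff_disjoint_right]
  constructor
  · rintro ⟨g, ⟨h1, h2⟩, rfl⟩
    exact ⟨fun h => h2 (Subtype.ext h), mem_powersetCard.1 g.2, fun h => h1 h.1⟩
  · rintro ⟨h1, h2, h3⟩
    exact ⟨⟨g, mem_powersetCard.2 h2⟩, ⟨fun h => h3 ⟨h, h2.2⟩, fun h => h1 (congrArg Subtype.val h)⟩, rfl⟩

lemma OC_real {V : Type*} [Fintype V] [DecidableEq V] (r n : ℕ) (hn : 1 ≤ n)
    (hcard : Fintype.card V = r * n) (M : Finset (Finset V))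
    (hM : ∀ v ∈ (univ : Finset V), #{e ∈ M | v ∈ e} = 1)
    (hMs : M ⊆ powersetCard r univ) (hMn : #M = n)
    (e : {e : Finset V // e ∈ (powersetCard r univ : Finset (Finset V))}) (he : e.1 ∈ M)
    (t : Finset V) (hte : t ⊆ e.1) (ht : t.Nonempty) :
    (#(OC (N := #(powersetCard r univ : Finset (Finset V))) (setA M e) e (setB t e)) : ℝ) =
      (#(powersetCard r univ : Finset (Finset V))).factorial * ((n : ℝ)⁻¹ *
        ((((n * r).choose r - (n * r - #t).choose r + n - 1).choose n : ℕ) : ℝ)⁻¹) := by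
  have hA := setA_card M hMs e he
  have hB := setB_card r t e hte ht
  have hdisj : Disjoint (setA M e) (setB t e) := by
    rw [disjoint_left]
    intro g h1 h2
    simp only [setA, setB, mem_filter, mem_univ, true_and] at h1 h2
    obtain ⟨x, hx1, hx2⟩ := not_disjoint_iff.1 h2.1
    have := card_le_one.1 (hM x (mem_univ x)).le g.1 (by simp [h1.1, hx1]) e.1 (by simp [he, hte hx2])
    exact h1.2 (Subtype.ext this)
  have heA : e ∉ setA M e := by simp [setA]
  have heB : e ∉ setB t e := by simp [setB]
  have hle : #(setA M e) + #(setB t e) + 1 ≤ #(powersetCard r univ : Finset (Finset V)) := by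
    rw [← card_union_of_disjoint hdisj, ← card_insert_of_notMem (a := e) (by simp [heA, heB])]
    exact (card_le_univ _).trans (by simp)
  have hc := OC_count (N := #(powersetCard r univ : Finset (Finset V))) (by simp) e
    (#(powersetCard r univ : Finset (Finset V)) - (#(setA M e) + #(setB t e) + 1))
    _ _ heA heB hdisj (by omega)
  have hd : 1 ≤ (n * r).choose r - (n * r - #t).choose r := by
    have hpos : 0 < #t := ht.card_pos
    have htr : #t ≤ r := by
      have := (mem_powersetCard.1 e.2).2; rw [← this]; exact card_le_card hte
    have hr : 0 < r := by omega
    have h1 : n * r - #t ≤ n * r - 1 := by omega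
    have h2 := Nat.choose_le_choose r h1
    have hnr : r ≤ n * r := Nat.le_mul_of_pos_left _ hn
    obtain ⟨m, hm⟩ : ∃ m, n * r = m + 1 := ⟨n * r - 1, by omega⟩
    obtain ⟨q, hq⟩ : ∃ q, r = q + 1 := ⟨r - 1, by omega⟩
    have h3 : (n*r).choose r = m.choose q + m.choose r := by
      rw [hm, hq]; exact Nat.choose_succ_succ m q
    have h4 : 0 < m.choose q := Nat.choose_pos (by omega)
    rw [hm] at h2 h3 ⊢
    simp only [Nat.add_sub_cancel] at h2
    omega
  rw [hMn] at hA
  rw [hcard, mul_comm r n] at hB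
  generalize (n * r).choose r - (n * r - #t).choose r = d at hB hd ⊢
  obtain ⟨d, rfl⟩ : ∃ d', d = d' + 1 := ⟨d - 1, by omega⟩
  obtain ⟨n, rfl⟩ : ∃ n', n = n' + 1 := ⟨n - 1, by omega⟩
  simp only [Nat.add_sub_cancel] at hA hB
  rw [hA, hB] at hc
  have e1 : d + 1 + (n + 1) - 1 = d + (n + 1) := by omega
  rw [e1]
  have hch := Nat.add_choose_mul_factorial_mul_factorial d (n+1)
  have e2 : n + d + 1 = d + (n+1) := by ring
  rw [e2, ← hch, Nat.factorial_succ] at hc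
  have hch0 : 0 < (d + (n+1)).choose (n+1) := Nat.choose_pos (by omega)
  have hsymm : (d + (n+1)).choose d = (d + (n+1)).choose (n+1) := Nat.choose_symm_add
  have hc' : (#(OC (N := #(powersetCard r univ : Finset (Finset V))) (setA M e) e (setB t e))) * ((n + 1) * (d + (n+1)).choose (n+1)) =
     (#(powersetCard r univ : Finset (Finset V))).factorial := by
    apply Nat.eq_of_mul_eq_mul_left (Nat.mul_pos (Nat.factorial_pos n) (Nat.factorial_pos d))
    rw [← hc]
    try rw [hsymm]
    ring
  rw [← hc']
  have : ((d + (n+1)).choose (n+1) : ℝ) ≠ 0 := by positivity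
  push_cast
  field_simp

lemma match_count {V : Type*} [Fintype V] [DecidableEq V] (r n : ℕ) (hr : 2 ≤ r) (hn : 1 ≤ n)
    (hcard : Fintype.card V = r * n) (M : Finset (Finset V)) (hMP : M ∈ PM r univ) :
    (#(univ.filter (fun ω : Fin (Finset.univ.powersetCard r : Finset (Finset V)).card ≃
        {e : Finset V // e ∈ (Finset.univ.powersetCard r : Finset (Finset V))} =>
          M ⊆ hFinal ω)) : ℝ) = (#(powersetCard r univ : Finset (Finset V))).factorial *
      ∑ i ∈ Finset.Icc 1 r, (-1 : ℝ) ^ (i - 1) * (r.choose i : ℝ) /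
        (((n * r).choose r - (n * r - i).choose r + n - 1).choose n : ℝ) := by
  have hMn : #M = n := by
    have := PM_card_mem hMP
    rw [card_univ, hcard] at this
    exact Nat.eq_of_mul_eq_mul_left (by omega) this
  simp only [PM, mem_filter, mem_powerset] at hMP
  obtain ⟨hMs, hM⟩ := hMP
  haveI : Nonempty V := by
    rw [← Fintype.card_pos_iff, hcard]; positivity
  have hMex : ∀ v : V, ∃ e ∈ M, v ∈ e := by
    intro v
    have : 0 < #{e ∈ M | v ∈ e} := by rw [hM v (mem_univ _)]; exact one_pos
    obtain ⟨e, he⟩ := card_pos.1 this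
    exact ⟨e, by simpa using he⟩
  set E := (powersetCard r univ : Finset (Finset V)) with hE
  have hset : (univ.filter (fun ω : Fin E.card ≃ {e : Finset V // e ∈ E} => M ⊆ hFinal ω)) =
      (univ.filter (fun e : {e : Finset V // e ∈ E} => e.1 ∈ M)).biUnion
        (fun e => e.1.biUnion (fun v => OC (setA M e) e (setB {v} e))) := by
    ext ω
    simp only [mem_filter, mem_univ, true_and, mem_biUnion]
    exact final_char ω M hMs hMex
  have hin : ∀ e ∈ univ.filter (fun e : {e : Finset V // e ∈ E} => e.1 ∈ M),
      (#(e.1.biUnion (fun v => OC (N := #E) (setA M e) e (setB {v} e))) : ℝ) =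
      (#E).factorial * ((n : ℝ)⁻¹ * ∑ i ∈ Finset.Icc 1 r, (-1 : ℝ) ^ (i - 1) * (r.choose i : ℝ) /
        (((n * r).choose r - (n * r - i).choose r + n - 1).choose n : ℝ)) := by
    intro e he
    simp only [mem_filter, mem_univ, true_and] at he
    have her : #e.1 = r := (mem_powersetCard.1 e.2).2
    let F : ℕ → ℝ := fun i => (-1 : ℝ) ^ (i + 1) *
      (((n * r).choose r - (n * r - i).choose r + n - 1).choose n : ℝ)⁻¹
    have hie := Finset.inclusion_exclusion_card_biUnion e.1
      (fun v => OC (N := #E) (setA M e) e (setB {v} e))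
    have hie' : (#(e.1.biUnion (fun v => OC (N := #E) (setA M e) e (setB {v} e))) : ℝ) =
        ∑ t ∈ e.1.powerset.filter (·.Nonempty), (#E).factorial * (n : ℝ)⁻¹ * F (#t) := by
      have := congrArg (Int.cast : ℤ → ℝ) hie
      push_cast at this
      rw [this, ← Finset.sum_coe_sort (e.1.powerset.filter (·.Nonempty))]
      apply Finset.sum_congr rfl
      intro t _
      have ht := t.2
      simp only [mem_filter, mem_powerset] at ht
      have hi : (t.1.inf' ht.2 (fun v => OC (N := #E) (setA M e) e (setB {v} e))) =
          OC (setA M e) e (setB t.1 e) := by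
        ext ω
        simp only [mem_inf', OC, mem_filter, mem_univ, true_and]
        constructor
        · intro h
          obtain ⟨x, hx⟩ := ht.2
          refine ⟨(h x hx).1, fun b hb => ?_⟩
          simp only [setB, mem_filter, mem_univ, true_and] at hb
          obtain ⟨y, hy1, hy2⟩ := not_disjoint_iff.1 hb.1
          exact (h y hy2).2 b (by simp [setB, hy1, hb.2])
        · rintro ⟨h1, h2⟩ v hv
          refine ⟨h1, fun b hb => h2 b ?_⟩
          simp only [setB, mem_filter, mem_univ, true_and, disjoint_singleton_right, not_not] at hb ⊢
          exact ⟨not_disjoint_iff.2 ⟨v, hb.1, hv⟩, hb.2⟩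
      rw [hi, OC_real r n hn hcard M hM hMs hMn e he t.1 ht.1 ht.2]
      simp only [F]
      ring
    rw [hie', ← mul_sum, mul_assoc]
    congr 2
    have hsum : ∑ t ∈ e.1.powerset.filter (·.Nonempty), F (#t) =
        ∑ t ∈ e.1.powerset, (fun k => if k = 0 then 0 else F k) (#t) := by
      rw [sum_filter]
      apply sum_congr rfl
      intro t _
      by_cases h : t = ∅
      · simp [h]
      · simp [h, nonempty_iff_ne_empty]
    rw [hsum, Finset.sum_powerset_apply_card (fun k => if k = 0 then 0 else F k), her,
      Finset.sum_range_succ']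
    simp only [Nat.add_eq_zero_iff, one_ne_zero, and_false, if_false, if_true, smul_zero, add_zero]
    rw [← Finset.Ico_add_one_right_eq_Icc, Finset.sum_Ico_eq_sum_range]
    apply sum_congr (by simp)
    intro i _
    simp only [F, nsmul_eq_mul, add_comm 1 i, Nat.add_sub_cancel]
    rw [pow_succ, pow_succ]
    ring
  rw [hset, card_biUnion, Nat.cast_sum, sum_congr rfl hin, sum_const, nsmul_eq_mul]
  · have : #(univ.filter (fun e : {e : Finset V // e ∈ E} => e.1 ∈ M)) = n := by
      rw [← hMn, ← card_map (Function.Embedding.subtype _)]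
      congr 1
      ext g
      simp only [mem_map, mem_filter, mem_univ, true_and, Function.Embedding.subtype_apply]
      constructor
      · rintro ⟨g, h, rfl⟩; exact h
      · intro h; exact ⟨⟨g, hMs h⟩, h, rfl⟩
    rw [this]
    have : (n : ℝ) ≠ 0 := by positivity
    field_simp
  · intro e he e' he' hne
    simp only [coe_filter, mem_univ, true_and, Set.mem_ofPred_eq] at he he'
    simp only [Function.onFun]
    rw [disjoint_left]
    intro ω h1 h2
    simp only [mem_biUnion, OC, mem_filter, mem_univ, true_and, setA] at h1 h2
    obtain ⟨_, _, h1, _⟩ := h1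
    obtain ⟨_, _, h2, _⟩ := h2
    exact lt_asymm (h1 e' ⟨he', hne.symm⟩) (h2 e ⟨he, hne⟩)

/-- Let `V` be a set of `rn` vertices and `E` the set of all `r`-element subsets of `V`.
Take the elements of `E` in a uniformly random order, stopping as soon as every vertex is
covered; this gives a random `r`-uniform hypergraph `G_ω`.  The expected number of
matchings contained in `G_ω` equals
`((rn)!/((r!)^n n!)) · Σ_{i=1}^{r} (−1)^{i−1} C(r,i) / C(C(nr,r) − C(nr−i,r) + n − 1, n)`. -/
theorem expected_number_of_matchings_complete_hypergraph
    {V : Type*} [Fintype V] [DecidableEq V] (r n : ℕ) (hr : 2 ≤ r) (hn : 1 ≤ n)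
    (hcard : Fintype.card V = r * n) :
    (∑ ω : Fin (Finset.univ.powersetCard r : Finset (Finset V)).card ≃
        {e : Finset V // e ∈ (Finset.univ.powersetCard r : Finset (Finset V))},
        ({M : Finset (Finset V) | M ⊆ hFinal ω ∧ hIsMatching M}.ncard : ℝ)) /
      (Fintype.card (Fin (Finset.univ.powersetCard r : Finset (Finset V)).card ≃
        {e : Finset V // e ∈ (Finset.univ.powersetCard r : Finset (Finset V))}) : ℝ) =
    ((r * n).factorial : ℝ) / ((r.factorial : ℝ) ^ n * (n.factorial : ℝ)) *
      ∑ i ∈ Finset.Icc 1 r, (-1 : ℝ) ^ (i - 1) * (r.choose i : ℝ) /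
        (((n * r).choose r - (n * r - i).choose r + n - 1).choose n : ℝ) := by
  set E := (powersetCard r univ : Finset (Finset V)) with hE
  have hset : ∀ ω : Fin E.card ≃ {e : Finset V // e ∈ E},
      ({M : Finset (Finset V) | M ⊆ hFinal ω ∧ hIsMatching M}.ncard : ℝ) =
      ∑ M ∈ PM r univ, if M ⊆ hFinal ω then (1 : ℝ) else 0 := by
    intro ω
    rw [Finset.sum_boole, ← Set.ncard_coe_finset]
    congr 2
    ext M
    simp only [Set.mem_ofPred_eq, coe_filter, PM, mem_filter, mem_powerset, mem_univ, true_imp_iff]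
    have hm : hIsMatching M ↔ ∀ v : V, #{e ∈ M | v ∈ e} = 1 := by
      unfold hIsMatching
      refine forall_congr' fun v => ?_
      rw [Finset.card_eq_one]
      constructor
      · rintro ⟨e, he, hu⟩
        refine ⟨e, ?_⟩
        ext x
        simp only [mem_filter, mem_singleton]
        exact ⟨fun h => hu x h, fun h => h ▸ he⟩
      · rintro ⟨e, he⟩
        have : ∀ x, (x ∈ M ∧ v ∈ x) ↔ x = e := by
          intro x
          rw [← mem_singleton, ← he, mem_filter]
        exact ⟨e, (this e).2 rfl, fun y hy => (this y).1 hy⟩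
    rw [hm]
    constructor
    · rintro ⟨h1, h2⟩
      refine ⟨⟨fun e he => ?_, h2⟩, h1⟩
      exact ((mem_hPrefix _ _ _).1 (h1 he)).1
    · rintro ⟨⟨_, h2⟩, h1⟩
      exact ⟨h1, h2⟩
  rw [sum_congr rfl (fun ω _ => hset ω), sum_comm]
  have h1 : ∀ M ∈ PM r (univ : Finset V), (∑ ω : Fin E.card ≃ {e : Finset V // e ∈ E},
      if M ⊆ hFinal ω then (1 : ℝ) else 0) = (#E).factorial *
      ∑ i ∈ Finset.Icc 1 r, (-1 : ℝ) ^ (i - 1) * (r.choose i : ℝ) /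
        (((n * r).choose r - (n * r - i).choose r + n - 1).choose n : ℝ) := by
    intro M hM
    rw [Finset.sum_boole]
    exact match_count r n hr hn hcard M hM
  rw [sum_congr rfl h1, sum_const, nsmul_eq_mul]
  have hc : ∀ i : Fintype (Fin E.card ≃ {e : Finset V // e ∈ E}),
      @Fintype.card _ i = (#E).factorial := by
    have h := Fintype.card_equiv (Fintype.equivOfCardEq (by simp) : Fin E.card ≃ {e : Finset V // e ∈ E})
    rw [Fintype.card_fin] at h
    intro i
    rw [← h]
    congr 1
    exact Subsingleton.elim _ _
  rw [hc]
  have hP := PM_count (r := r) (by omega) n (univ : Finset V) (by rw [card_univ, hcard])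
  rw [← hP]
  have : ((#E).factorial : ℝ) ≠ 0 := by positivity
  have : (r.factorial : ℝ) ≠ 0 := by positivity
  have : (n.factorial : ℝ) ≠ 0 := by positivity
  push_cast
  field_simp
end

section
/- Label the vertices of the complete r-partite graph K_{n,…,n} as v_{i,j} for 1 ≤ i ≤ r and 1 ≤ j ≤ n, write (j(1), …, j(r)) for the transversal edge {v_{1,j(1)}, …, v_{r,j(r)}}, and let M = {(1,…,1), …, (n,…,n)} be the diagonal matching. Then for each i with 1 ≤ i ≤ r, the probability that M ⊆ G_ω, that e_{k(ω)} = (n, …, n), and that the vertices v_{1,n}, …, v_{i,n} all have degree one in G_ω, equals (1/n) · binom(n^r − (n−1)^i · n^{r−i} + n − 1, n)^{−1}. -/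
open Finset

/-- `e` is the last edge `e_{k(ω)}` of the random hypergraph `G_ω`: it belongs to the
first `k(ω)` edges but not to the first `k(ω) − 1` edges. -/
noncomputable def hLastEdgeIs {V : Type*} [Fintype V] [DecidableEq V]
    {s : Finset (Finset V)} (ω : Fin s.card ≃ {e : Finset V // e ∈ s})
    (e : Finset V) : Prop :=
  e ∈ hPrefix ω (hStop ω) ∧ e ∉ hPrefix ω (hStop ω - 1)

/-- The "diagonal" edge `(j, …, j) = {v_{1,j}, …, v_{r,j}}`. -/
def diagEdge (r n : ℕ) (j : Fin n) : Finset (Fin r × Fin n) :=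
  Finset.univ.image (fun i : Fin r => (i, j))

/-- The diagonal matching `M = {(1,…,1), …, (n,…,n)}`. -/
def diagMatching (r n : ℕ) : Finset (Finset (Fin r × Fin n)) :=
  Finset.univ.image (diagEdge r n)

theorem aux_perm_count {T α : Type*} [Fintype T] [DecidableEq T] [LinearOrder α]
    (p : T → α) (hp : Function.Injective p) (c : T → Fin 3) :
    Fintype.card {σ : Equiv.Perm T // ∀ t t', c t < c t' → p (σ t) < p (σ t')} =
      ∏ k : Fin 3, (Fintype.card {t // c t = k}).factorial := by
  classical
  set m := Fintype.card T with hm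
  let e : T ≃ Fin m := Fintype.equivFin T
  let u : Fin m ≃ T := (Tuple.sort (p ∘ e.symm)).trans e.symm
  have hu : StrictMono (p ∘ u) := by
    have h1 : Monotone (p ∘ u) := Tuple.monotone_sort (p ∘ e.symm)
    exact h1.strictMono_of_injective (hp.comp u.injective)
  let f : Fin m → Fin 3 := c ∘ e.symm
  let ρ0 := Tuple.sort f
  have key : ∀ σ : Equiv.Perm T, (∀ t t', c t < c t' → p (σ t) < p (σ t')) ↔
      f ∘ ((u.trans σ.symm).trans e) = f ∘ ρ0 := by
    intro σ
    rw [Tuple.comp_sort_eq_comp_iff_monotone]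
    constructor
    · intro h a b hab
      by_contra hlt
      push Not at hlt
      have := h (σ.symm (u b)) (σ.symm (u a)) (by simpa [f] using hlt)
      simp only [Equiv.apply_symm_apply] at this
      exact absurd (hu.lt_iff_lt.1 this) (not_lt.2 hab)
    · intro h t t' hc
      by_contra hle
      push Not at hle
      have h2 : u.symm (σ t') ≤ u.symm (σ t) := by
        rw [← hu.le_iff_le]; simpa using hle
      have := h h2
      simp [f] at this
      exact absurd this (not_le.2 hc)
  have e1 : {σ : Equiv.Perm T // ∀ t t', c t < c t' → p (σ t) < p (σ t')} ≃
      {g : Equiv.Perm T // c ∘ g = c} := by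
    let Φ : Equiv.Perm T ≃ Equiv.Perm T :=
      { toFun := fun σ => ((e.trans ρ0.symm).trans u).trans σ.symm
        invFun := fun g => (g.symm.trans ((e.trans ρ0.symm).trans u))
        left_inv := by intro σ; ext; simp
        right_inv := by intro σ; ext; simp }
    refine Equiv.subtypeEquiv Φ ?_
    intro σ
    rw [key]
    constructor
    · intro h
      funext t
      have := congrFun h (ρ0.symm (e t))
      simpa [f, Φ] using this
    · intro h
      funext a
      have := congrFun h (e.symm (ρ0 a))
      simpa [f, Φ] using this
  rw [Fintype.card_congr e1]
  exact DomMulAct.stabilizer_card c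

theorem aux_order_count {E : Type*} [Fintype E] [DecidableEq E] {N : ℕ}
    (P : E → Prop) [DecidablePred P] (c : E → Fin 3) :
    Nat.card {ω : Fin N ≃ E // ∀ t t', P t → P t' → c t < c t' → ω.symm t < ω.symm t'} *
      (Fintype.card {t // P t}).factorial =
    Fintype.card (Fin N ≃ E) * ∏ k : Fin 3, (Fintype.card {t // P t ∧ c t = k}).factorial := by
  classical
  let good : (Fin N ≃ E) → Prop := fun ω =>
    ∀ t t', P t → P t' → c t < c t' → ω.symm t < ω.symm t'
  have hdc := Finset.sum_card_bipartiteAbove_eq_sum_card_bipartiteBelow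
    (s := (univ : Finset (Fin N ≃ E))) (t := (univ : Finset (Equiv.Perm {t // P t})))
    (fun ω σ => good (ω.trans (Equiv.Perm.ofSubtype σ).symm))
  have hA : ∀ ω : Fin N ≃ E, (bipartiteAbove (fun (ω : Fin N ≃ E) (σ : Equiv.Perm {t // P t}) =>
      good (ω.trans (Equiv.Perm.ofSubtype σ).symm)) univ ω).card =
      ∏ k : Fin 3, (Fintype.card {t // P t ∧ c t = k}).factorial := by
    intro ω
    have := aux_perm_count (T := {t // P t}) (fun t => ω.symm t.1)
      (fun a b h => Subtype.ext (ω.symm.injective h)) (fun t => c t.1)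
    rw [bipartiteAbove, ← Fintype.card_subtype]
    have h3 : ∀ k, Fintype.card {t : {t // P t} // c t.1 = k} =
        Fintype.card {t // P t ∧ c t = k} := fun k =>
      Fintype.card_congr (Equiv.subtypeSubtypeEquivSubtypeInter P (fun t => c t = k))
    simp only [h3] at this
    rw [← this]
    refine Fintype.card_congr (Equiv.subtypeEquivRight ?_)
    intro σ
    constructor
    · intro h t t' hc
      have := h t t' t.2 t'.2 hc
      simpa [Equiv.Perm.ofSubtype_apply_coe] using this
    · intro h t t' ht ht' hc
      have := h ⟨t, ht⟩ ⟨t', ht'⟩ hc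
      simpa [Equiv.Perm.ofSubtype_apply_of_mem, ht, ht'] using this
  have hB : ∀ σ : Equiv.Perm {t // P t}, (bipartiteBelow (fun (ω : Fin N ≃ E)
      (σ : Equiv.Perm {t // P t}) =>
      good (ω.trans (Equiv.Perm.ofSubtype σ).symm)) univ σ).card =
      Nat.card {ω : Fin N ≃ E // good ω} := by
    intro σ
    rw [bipartiteBelow, ← Fintype.card_subtype, ← Nat.card_eq_fintype_card]
    refine Nat.card_congr (Equiv.subtypeEquiv
      (Equiv.equivCongr (Equiv.refl _) (Equiv.Perm.ofSubtype σ).symm) ?_)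
    intro ω
    rfl
  rw [Finset.sum_congr rfl (fun ω _ => hA ω), Finset.sum_congr rfl (fun σ _ => hB σ)] at hdc
  simp only [Finset.sum_const, Finset.card_univ, smul_eq_mul, Fintype.card_perm] at hdc
  rw [hdc, mul_comm]

def auxEdge {r n : ℕ} (g : Fin r → Fin n) : Finset (Fin r × Fin n) :=
  Finset.univ.image (fun i : Fin r => (i, g i))

theorem mem_auxEdge {r n : ℕ} (g : Fin r → Fin n) (x : Fin r × Fin n) :
    x ∈ auxEdge g ↔ g x.1 = x.2 := by
  rcases x with ⟨a, b⟩
  simp [auxEdge]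

theorem auxEdge_mem {r n : ℕ} (g : Fin r → Fin n) : auxEdge g ∈ transversals r n := by
  simp only [transversals, Finset.mem_filter, Finset.mem_univ, true_and]
  intro i
  rw [Finset.card_eq_one]
  refine ⟨(i, g i), ?_⟩
  ext ⟨a, b⟩
  simp only [Finset.mem_filter, mem_auxEdge, Finset.mem_singleton, Prod.mk.injEq]
  constructor
  · rintro ⟨h, rfl⟩; exact ⟨rfl, h.symm⟩
  · rintro ⟨rfl, rfl⟩; exact ⟨rfl, rfl⟩

theorem auxEdge_bij {r n : ℕ} : Function.Bijective
    (fun g : Fin r → Fin n => (⟨auxEdge g, auxEdge_mem g⟩ : {e // e ∈ transversals r n})) := by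
  constructor
  · intro g h hgh
    have h1 : auxEdge g = auxEdge h := congrArg Subtype.val hgh
    funext i
    have : (i, g i) ∈ auxEdge h := by rw [← h1, mem_auxEdge]
    rw [mem_auxEdge] at this
    exact this.symm
  · rintro ⟨e, he⟩
    have he' := he
    simp only [transversals, Finset.mem_filter, Finset.mem_univ, true_and,
      Finset.card_eq_one] at he'
    choose x hx using he'
    have h1 : ∀ i, x i ∈ e ∧ (x i).1 = i := fun i => by
      have : x i ∈ e.filter (fun y => y.1 = i) := by rw [hx]; simp
      simpa using this
    refine ⟨fun i => (x i).2, Subtype.ext ?_⟩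
    ext ⟨a, b⟩
    rw [mem_auxEdge]
    constructor
    · intro h
      have h2 := h1 a
      have : x a = (a, b) := Prod.ext h2.2 h
      rw [← this]; exact h2.1
    · intro h
      have : (a, b) ∈ e.filter (fun y => y.1 = a) := by simp [h]
      rw [hx, Finset.mem_singleton] at this
      simp [← this]

noncomputable def auxEquiv (r n : ℕ) : (Fin r → Fin n) ≃ {e // e ∈ transversals r n} :=
  Equiv.ofBijective _ auxEdge_bij

theorem auxEquiv_val {r n : ℕ} (g : Fin r → Fin n) :
    ((auxEquiv r n g : {e // e ∈ transversals r n}) : Finset (Fin r × Fin n)) = auxEdge g := rfl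

theorem auxEquiv_symm {r n : ℕ} (x : {e // e ∈ transversals r n}) :
    auxEdge ((auxEquiv r n).symm x) = x.1 := by
  rw [← auxEquiv_val, Equiv.apply_symm_apply]

def auxS {r n : ℕ} (i : ℕ) (L : Fin n) (g : Fin r → Fin n) : Prop :=
  ∃ a : Fin r, (a : ℕ) < i ∧ g a = L

def auxP {r n : ℕ} (i : ℕ) (L : Fin n) (g : Fin r → Fin n) : Prop :=
  (∃ j, g = fun _ => j) ∨ auxS i L g

open Classical in
noncomputable def auxC {r n : ℕ} (i : ℕ) (L : Fin n) (g : Fin r → Fin n) : Fin 3 :=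
  if g = (fun _ => L) then 1 else if auxS i L g then 2 else 0

open Classical in
theorem aux_cardS {r n i : ℕ} (L : Fin n) (hir : i ≤ r) :
    Fintype.card {g : Fin r → Fin n // auxS i L g} = n ^ r - (n - 1) ^ i * n ^ (r - i) := by
  have h1 : Fintype.card {g : Fin r → Fin n // ¬ auxS i L g} = (n - 1) ^ i * n ^ (r - i) := by
    rw [Fintype.card_subtype]
    have : (univ.filter (fun g : Fin r → Fin n => ¬ auxS i L g)) =
        Fintype.piFinset (fun a : Fin r => if (a : ℕ) < i then univ.erase L else univ) := by
      ext g
      rw [Finset.mem_filter, Fintype.mem_piFinset]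
      simp only [auxS, Finset.mem_univ, true_and, not_exists, not_and]
      refine forall_congr' fun a => ?_
      split_ifs with h <;> simp [h]
    rw [this, Fintype.card_piFinset]
    have h2 : ∀ a : Fin r, (if (a : ℕ) < i then univ.erase L else (univ : Finset (Fin n))).card =
        if (a : ℕ) < i then n - 1 else n := by
      intro a
      split_ifs <;> simp
    simp only [h2]
    rw [Fin.prod_univ_eq_prod_range (fun a => if a < i then n - 1 else n) r]
    obtain ⟨d, rfl⟩ := Nat.exists_eq_add_of_le hir
    rw [Finset.prod_range_add]
    congr 1
    · rw [Finset.prod_congr rfl (g := fun _ => n - 1)]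
      · simp
      · intro x hx; simp [Finset.mem_range.1 hx]
    · simp
  have h2 := Fintype.card_subtype_compl (fun g : Fin r → Fin n => auxS i L g)
  have h3 := Fintype.card_subtype_le (fun g : Fin r → Fin n => auxS i L g)
  rw [h1] at h2
  simp only [Fintype.card_fun, Fintype.card_fin] at h2 h3
  omega

open Classical in
theorem aux_fib {r n i : ℕ} (L : Fin n) (hr : 1 ≤ r) (hi1 : 1 ≤ i) (hir : i ≤ r) :
    Fintype.card {g : Fin r → Fin n // auxP i L g ∧ auxC i L g = 0} = n - 1 ∧
    Fintype.card {g : Fin r → Fin n // auxP i L g ∧ auxC i L g = 1} = 1 ∧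
    Fintype.card {g : Fin r → Fin n // auxP i L g ∧ auxC i L g = 2} + 1 =
      n ^ r - (n - 1) ^ i * n ^ (r - i) ∧
    Fintype.card {g : Fin r → Fin n // auxP i L g} + 1 =
      n + (n ^ r - (n - 1) ^ i * n ^ (r - i)) := by
  have hLS : auxS (r := r) i L (fun _ => L) := ⟨⟨0, by omega⟩, by simp; omega, rfl⟩
  have hn : 1 ≤ n := by have := L.2; omega
  have hcS : ∀ j, auxS (r := r) i L (fun _ => j) → j = L := by
    rintro j ⟨a, _, h⟩; exact h
  have h0 : Fintype.card {g : Fin r → Fin n // auxP i L g ∧ auxC i L g = 0} = n - 1 := by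
    rw [Fintype.card_subtype]
    have : (univ.filter (fun g : Fin r → Fin n => auxP i L g ∧ auxC i L g = 0)) =
        (univ.erase L).image (fun j => fun _ => j) := by
      ext g
      simp only [Finset.mem_filter, Finset.mem_univ, true_and, Finset.mem_image,
        Finset.mem_erase, and_true]
      constructor
      · rintro ⟨hP, hC⟩
        have hS : ¬ auxS i L g ∧ g ≠ fun _ => L := by
          unfold auxC at hC
          split_ifs at hC <;> simp_all
        rcases hP with ⟨j, rfl⟩ | h
        · exact ⟨j, fun h => hS.2 (by rw [h]), rfl⟩
        · exact absurd h hS.1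
      · rintro ⟨j, hj, rfl⟩
        refine ⟨Or.inl ⟨j, rfl⟩, ?_⟩
        unfold auxC
        rw [if_neg, if_neg]
        · intro h; exact hj (hcS j h)
        · intro h; exact hj (congrFun h ⟨0, by omega⟩)
    rw [this, Finset.card_image_of_injective]
    · simp
    · intro a b h; exact congrFun h ⟨0, by omega⟩
  have h1 : Fintype.card {g : Fin r → Fin n // auxP i L g ∧ auxC i L g = 1} = 1 := by
    rw [Fintype.card_subtype, Finset.card_eq_one]
    refine ⟨fun _ => L, ?_⟩
    ext g
    simp only [Finset.mem_filter, Finset.mem_univ, true_and, Finset.mem_singleton]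
    constructor
    · rintro ⟨_, hC⟩
      unfold auxC at hC
      split_ifs at hC <;> simp_all
    · rintro rfl
      exact ⟨Or.inr hLS, by simp [auxC]⟩
  have h2 : Fintype.card {g : Fin r → Fin n // auxP i L g ∧ auxC i L g = 2} + 1 =
      n ^ r - (n - 1) ^ i * n ^ (r - i) := by
    rw [← aux_cardS L hir, Fintype.card_subtype, Fintype.card_subtype]
    rw [← Finset.card_erase_add_one (s := univ.filter (fun g : Fin r → Fin n => auxS i L g))
      (a := fun _ => L) (by simpa using hLS)]
    congr 2
    ext g
    simp only [Finset.mem_filter, Finset.mem_univ, true_and, Finset.mem_erase]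
    constructor
    · rintro ⟨_, hC⟩
      unfold auxC at hC
      split_ifs at hC <;> simp_all
    · rintro ⟨h, h'⟩
      exact ⟨Or.inr h', by simp [auxC, h, h']⟩
  refine ⟨h0, h1, h2, ?_⟩
  have h3 : Fintype.card {g : Fin r → Fin n // auxP i L g} =
      ∑ k : Fin 3, Fintype.card {g : Fin r → Fin n // auxP i L g ∧ auxC i L g = k} := by
    simp only [Fintype.card_subtype]
    rw [Finset.card_eq_sum_card_fiberwise (f := auxC i L) (t := univ) (by simp)]
    simp only [Finset.filter_filter]
  rw [h3, Fin.sum_univ_three, h0, h1]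
  omega

theorem mem_hPrefix_iff {V : Type*} [DecidableEq V] {s : Finset (Finset V)}
    (ω : Fin s.card ≃ {e : Finset V // e ∈ s}) (k : ℕ) (e : Finset V) :
    e ∈ hPrefix ω k ↔ ∃ h : e ∈ s, (ω.symm ⟨e, h⟩ : ℕ) < k := by
  simp only [hPrefix, Finset.mem_image, Finset.mem_filter, Finset.mem_univ, true_and]
  constructor
  · rintro ⟨j, hj, rfl⟩
    exact ⟨(ω j).2, by simpa using hj⟩
  · rintro ⟨h, hk⟩
    exact ⟨_, hk, by simp⟩

theorem aux_event_s14 {r n i : ℕ} (L : Fin n) (hr : 1 ≤ r) (hi1 : 1 ≤ i)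
    (ω : Fin (transversals r n).card ≃ {e : Finset (Fin r × Fin n) // e ∈ transversals r n}) :
    (diagMatching r n ⊆ hFinal ω ∧ hLastEdgeIs ω (diagEdge r n L) ∧
      ∀ i' : Fin r, (i' : ℕ) < i → hDegIn (hFinal ω) (i', L) = 1) ↔
    (∀ t t' : Fin r → Fin n, auxP i L t → auxP i L t' → auxC i L t < auxC i L t' →
      ω.symm (auxEquiv r n t) < ω.symm (auxEquiv r n t')) := by
  classical
  set pos : (Fin r → Fin n) → ℕ := fun g => (ω.symm (auxEquiv r n g) : ℕ) with hpos
  have hinj : Function.Injective pos := fun a b h =>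
    (auxEquiv r n).injective (ω.symm.injective (Fin.ext h))
  have hmem : ∀ k g, auxEdge g ∈ hPrefix ω k ↔ pos g < k := by
    intro k g
    rw [mem_hPrefix_iff]
    exact ⟨fun ⟨_, h⟩ => h, fun h => ⟨auxEdge_mem g, h⟩⟩
  have hex : ∀ k e, e ∈ hPrefix ω k → ∃ g, e = auxEdge g := by
    intro k e he
    obtain ⟨h, _⟩ := (mem_hPrefix_iff _ _ _).1 he
    exact ⟨(auxEquiv r n).symm ⟨e, h⟩, (auxEquiv_symm ⟨e, h⟩).symm⟩
  have hdiag : ∀ j, diagEdge r n j = auxEdge (fun _ => j) := fun j => rfl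
  have hLS : auxS (r := r) i L (fun _ => L) := ⟨⟨0, by omega⟩, by simp; omega, rfl⟩
  have hC1 : auxC (r := r) i L (fun _ => L) = 1 := by simp [auxC]
  have hcS : ∀ j, auxS (r := r) i L (fun _ => j) → j = L := by
    rintro j ⟨a, _, h⟩; exact h
  have hC0 : ∀ j, j ≠ L → auxC (r := r) i L (fun _ => j) = 0 := by
    intro j hj
    unfold auxC
    rw [if_neg, if_neg]
    · intro h; exact hj (hcS j h)
    · intro h; exact hj (congrFun h ⟨0, by omega⟩)
  have hC2 : ∀ g : Fin r → Fin n, auxS i L g → g ≠ (fun _ => L) → auxC i L g = 2 := by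
    intro g h h'
    simp [auxC, h, h']
  have hM : ∀ k, diagMatching r n ⊆ hPrefix ω k ↔ ∀ j, pos (fun _ => j) < k := by
    intro k
    simp only [diagMatching, Finset.image_subset_iff, Finset.mem_univ, true_implies, hdiag, hmem]
  have hgood : (∀ t t' : Fin r → Fin n, auxP i L t → auxP i L t' → auxC i L t < auxC i L t' →
      ω.symm (auxEquiv r n t) < ω.symm (auxEquiv r n t')) ↔
      (∀ j, j ≠ L → pos (fun _ => j) < pos (fun _ => L)) ∧
      (∀ g, auxS i L g → g ≠ (fun _ => L) → pos (fun _ => L) < pos g) := by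
    constructor
    · intro h
      refine ⟨fun j hj => ?_, fun g hg hg' => ?_⟩
      · exact h _ _ (Or.inl ⟨j, rfl⟩) (Or.inl ⟨L, rfl⟩) (by rw [hC0 j hj, hC1]; decide)
      · exact h _ _ (Or.inl ⟨L, rfl⟩) (Or.inr hg) (by rw [hC2 g hg hg', hC1]; decide)
    · rintro ⟨hA, hB⟩
      have cl : ∀ t, auxP i L t → (t = (fun _ => L) ∧ auxC i L t = 1) ∨
          (pos t < pos (fun _ => L) ∧ auxC i L t = 0) ∨
          (pos (fun _ => L) < pos t ∧ auxC i L t = 2) := by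
        intro t ht
        by_cases h1 : t = (fun _ => L)
        · left; exact ⟨h1, by rw [h1, hC1]⟩
        right
        rcases ht with ⟨j, rfl⟩ | hS
        · have hj : j ≠ L := fun h => h1 (by rw [h])
          left; exact ⟨hA j hj, hC0 j hj⟩
        · right; exact ⟨hB t hS h1, hC2 t hS h1⟩
      intro t t' ht ht' hlt
      change pos t < pos t'
      rcases cl t ht with ⟨h, h'⟩ | ⟨h, h'⟩ | ⟨h, h'⟩ <;>
      rcases cl t' ht' with ⟨k, k'⟩ | ⟨k, k'⟩ | ⟨k, k'⟩ <;>
      rw [h', k'] at hlt <;> first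
        | (exfalso; revert hlt; decide)
        | (subst h; exact k)
        | (subst k; exact h)
        | omega
  rw [hgood]
  unfold hLastEdgeIs hFinal
  rw [hM, hdiag, hmem, hmem]
  constructor
  · rintro ⟨h1, ⟨h2, h3⟩, h4⟩
    refine ⟨fun j hj => ?_, fun g hg hg' => ?_⟩
    · have ha := h1 j
      have hb : pos (fun _ => j) ≠ pos (fun _ => L) := fun h =>
        hj (congrFun (hinj h) ⟨0, by omega⟩)
      omega
    · obtain ⟨a, ha, hga⟩ := hg
      by_contra hlt
      have hb : pos g < hStop ω := by omega
      have hd := h4 a ha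
      rw [hDegIn, Finset.card_eq_one] at hd
      obtain ⟨x, hx⟩ := hd
      have m1 : auxEdge g ∈ (hPrefix ω (hStop ω)).filter (fun e => (a, L) ∈ e) := by
        rw [Finset.mem_filter, hmem, mem_auxEdge]; exact ⟨hb, hga⟩
      have m2 : auxEdge (fun _ => L) ∈ (hPrefix ω (hStop ω)).filter (fun e => (a, L) ∈ e) := by
        rw [Finset.mem_filter, hmem, mem_auxEdge]; exact ⟨h2, rfl⟩
      rw [hx, Finset.mem_singleton] at m1 m2
      apply hg'
      apply (auxEquiv r n).injective
      apply Subtype.ext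
      rw [auxEquiv_val, auxEquiv_val, m1, m2]
  · rintro ⟨hA, hB⟩
    have hA' : ∀ j, pos (fun _ => j) < pos (fun _ => L) + 1 := by
      intro j
      by_cases hj : j = L
      · rw [hj]; omega
      · have := hA j hj; omega
    have hB' : ∀ g, auxS i L g → pos (fun _ => L) ≤ pos g := by
      intro g hg
      by_cases h : g = (fun _ => L)
      · rw [h]
      · exact (hB g hg h).le
    have hK : hStop ω = pos (fun _ => L) + 1 := by
      unfold hStop
      apply le_antisymm
      · apply Nat.sInf_le
        rintro ⟨a, j⟩
        exact ⟨auxEdge (fun _ => j), (hmem _ _).2 (hA' j), by rw [mem_auxEdge]⟩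
      · apply le_csInf
        · refine ⟨pos (fun _ => L) + 1, ?_⟩
          rintro ⟨a, j⟩
          exact ⟨auxEdge (fun _ => j), (hmem _ _).2 (hA' j), by rw [mem_auxEdge]⟩
        · intro k hk
          obtain ⟨e, he, hv⟩ := hk (⟨0, by omega⟩, L)
          obtain ⟨g, rfl⟩ := hex _ _ he
          rw [hmem] at he
          rw [mem_auxEdge] at hv
          have := hB' g ⟨⟨0, by omega⟩, by simp; omega, hv⟩
          omega
    rw [hK]
    refine ⟨hA', ⟨by omega, by omega⟩, fun a ha => ?_⟩
    rw [hDegIn, Finset.card_eq_one]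
    refine ⟨auxEdge (fun _ => L), ?_⟩
    ext e
    rw [Finset.mem_filter, Finset.mem_singleton]
    constructor
    · rintro ⟨he, hv⟩
      obtain ⟨g, rfl⟩ := hex _ _ he
      rw [hmem] at he
      rw [mem_auxEdge] at hv
      by_contra hne
      have := hB g ⟨a, ha, hv⟩ (fun h => hne (by rw [h]))
      omega
    · rintro rfl
      rw [hmem, mem_auxEdge]
      exact ⟨by omega, rfl⟩

/-- With the `n^r` transversal edges of `K_{n,…,n}` taken in a uniformly random order,
stopping when every vertex is covered, and with `M` the diagonal matching, the probability
that `M ⊆ G_ω`, that `e_{k(ω)} = (n,…,n)`, and that the vertices `v_{1,n}, …, v_{i,n}` all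
have degree one in `G_ω`, equals `(1/n) · C(n^r − (n−1)^i n^{r−i} + n − 1, n)⁻¹`. -/
theorem probability_diagonal_matching_with_last_edge (r n i : ℕ) (hr : 2 ≤ r)
    (hn : 1 ≤ n) (hi1 : 1 ≤ i) (hir : i ≤ r) :
    ({ω : Fin (transversals r n).card ≃
        {e : Finset (Fin r × Fin n) // e ∈ transversals r n} |
          diagMatching r n ⊆ hFinal ω ∧
          hLastEdgeIs ω (diagEdge r n ⟨n - 1, by omega⟩) ∧
          ∀ i' : Fin r, (i' : ℕ) < i →
            hDegIn (hFinal ω) (i', (⟨n - 1, by omega⟩ : Fin n)) = 1}.ncard : ℝ) /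
      (Fintype.card (Fin (transversals r n).card ≃
        {e : Finset (Fin r × Fin n) // e ∈ transversals r n}) : ℝ) =
    (1 / (n : ℝ)) * (((n ^ r - (n - 1) ^ i * n ^ (r - i) + n - 1).choose n : ℝ))⁻¹ := by
  classical
  obtain ⟨L, hL⟩ : ∃ L : Fin n, L = ⟨n - 1, by omega⟩ := ⟨_, rfl⟩
  rw [← hL]
  simp only [aux_event_s14 L (by omega : 1 ≤ r) hi1]
  have hc := aux_order_count (N := (transversals r n).card)
    (fun g : Fin r → Fin n => auxP i L g) (auxC i L)
  obtain ⟨h0, h1, h2, h3⟩ := aux_fib (r := r) L (by omega) hi1 hir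
  set s := n ^ r - (n - 1) ^ i * n ^ (r - i) with hs
  obtain ⟨b, hb⟩ : ∃ b, s = b + 1 := ⟨_, h2.symm⟩
  obtain ⟨a, rfl⟩ : ∃ a, n = a + 1 := ⟨n - 1, by omega⟩
  rw [Fin.prod_univ_three, h0, h1] at hc
  have h2' : Fintype.card {g : Fin r → Fin (a + 1) // auxP i L g ∧ auxC i L g = 2} = b := by omega
  have h3' : Fintype.card {g : Fin r → Fin (a + 1) // auxP i L g} = b + (a + 1) := by omega
  rw [h2', h3'] at hc
  rw [← Nat.card_coe_set_eq]
  have e1 : Fintype.card (Fin (transversals r (a + 1)).card ≃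
      {e : Finset (Fin r × Fin (a + 1)) // e ∈ transversals r (a + 1)}) =
      Fintype.card (Fin (transversals r (a + 1)).card ≃ (Fin r → Fin (a + 1))) :=
    Fintype.card_congr (Equiv.equivCongr (Equiv.refl _) (auxEquiv r (a + 1)).symm)
  have e2 : Nat.card {ω : Fin (transversals r (a + 1)).card ≃
      {e : Finset (Fin r × Fin (a + 1)) // e ∈ transversals r (a + 1)} |
      ∀ t t' : Fin r → Fin (a + 1), auxP i L t → auxP i L t' → auxC i L t < auxC i L t' →
      ω.symm (auxEquiv r (a + 1) t) < ω.symm (auxEquiv r (a + 1) t')} =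
      Nat.card {ω : Fin (transversals r (a + 1)).card ≃ (Fin r → Fin (a + 1)) //
        ∀ t t', auxP i L t → auxP i L t' → auxC i L t < auxC i L t' → ω.symm t < ω.symm t'} :=
    Nat.card_congr (Equiv.subtypeEquiv
      (Equiv.equivCongr (Equiv.refl _) (auxEquiv r (a + 1)).symm) (fun ω => Iff.rfl))
  rw [e2, e1, hb]
  have hpos : 0 < Fintype.card (Fin (transversals r (a + 1)).card ≃ (Fin r → Fin (a + 1))) := by
    rw [← e1]
    exact Fintype.card_pos_iff.2 ⟨(Fintype.equivFinOfCardEq (by simp)).symm⟩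
  have hch : (b + 1 + (a + 1) - 1).choose (a + 1) * (a + 1).factorial * b.factorial =
      (b + (a + 1)).factorial := by
    have h := Nat.add_choose_mul_factorial_mul_factorial b (a + 1)
    rw [show b + 1 + (a + 1) - 1 = b + (a + 1) by omega, ← h]
    ring
  have hcp : 0 < (b + 1 + (a + 1) - 1).choose (a + 1) := Nat.choose_pos (by omega)
  rw [← hch, Nat.factorial_succ, Nat.add_sub_cancel] at hc
  have hfa := Nat.factorial_pos a
  have hfb := Nat.factorial_pos b
  have hc' : Nat.card {ω : Fin (transversals r (a + 1)).card ≃ (Fin r → Fin (a + 1)) //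
        ∀ t t', auxP i L t → auxP i L t' → auxC i L t < auxC i L t' → ω.symm t < ω.symm t'} *
        ((a + 1) * (b + 1 + (a + 1) - 1).choose (a + 1)) =
      Fintype.card (Fin (transversals r (a + 1)).card ≃ (Fin r → Fin (a + 1))) := by
    apply Nat.eq_of_mul_eq_mul_right (Nat.mul_pos hfa hfb)
    rw [Nat.factorial_one, mul_one] at hc
    rw [← hc]
    ring
  rw [← hc'] at hpos ⊢
  have hx := Nat.pos_of_mul_pos_right hpos
  generalize Nat.card _ = X at *
  generalize (b + 1 + (a + 1) - 1).choose (a + 1) = Y at *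
  push_cast
  have : (X : ℝ) ≠ 0 := by
    rintro h
    have : X = 0 := by exact_mod_cast h
    simp [this] at hpos
  have : (Y : ℝ) ≠ 0 := by positivity
  field_simp
end
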